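/- Let d be a Dyck path on an n×n board of the form (d_1, d_2, n−1, …, n−1, n, …, n) (i.e., d_i ∈ {n−1, n} for all i ≥ 3) with bounce number 3, let P = P(d) and G = inc(P). Then the chromatic quasisymmetric function X_G(x,q) is e-positive: there exist polynomials c_λ(q) ∈ ℕ[q], indexed by partitions λ of n, such that for every N ≥ n, X_G(x_1,…,x_N;q) = Σ_{λ ⊢ n} c_λ(q) · e_{λ_1}(x_1,…,x_N) ⋯ e_{λ_ℓ}(x_1,…,x_N). -/

import Mathlib

open scoped Classical

/-- A Dyck path on an `n × n` board: a weakly increasing sequence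
`d 1 ≤ d 2 ≤ ⋯ ≤ d (n-1) ≤ n` with `i ≤ d i`; we record it on indices `1, …, n`
with the harmless boundary convention `d n = n`. -/
structure DyckPath (n : ℕ) where
  d : ℕ → ℕ
  mono : ∀ i j : ℕ, 1 ≤ i → i ≤ j → j ≤ n → d i ≤ d j
  le_n : ∀ i : ℕ, 1 ≤ i → i ≤ n → d i ≤ n
  ge_self : ∀ i : ℕ, 1 ≤ i → i ≤ n → i ≤ d i
  top : d n = n

namespace DyckPath

variable {n : ℕ}

/-- The natural unit interval order `P(d)`: `i ≺ j ↔ i < n ∧ j > d i`. -/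
def prec (D : DyckPath n) (i j : ℕ) : Prop := i < n ∧ D.d i < j

/-- Incomparability in `P(d)`; distinct incomparable vertices are the edges of `inc(P)`. -/
def Incomp (D : DyckPath n) (x y : ℕ) : Prop := ¬ D.prec x y ∧ ¬ D.prec y x

/-- The bounce sequence `m 0 = d 1`, `m (k+1) = d (m k + 1)`. -/
def bounce (D : DyckPath n) : ℕ → ℕ
  | 0 => D.d 1
  | k + 1 => D.d (D.bounce k + 1)

def m0 (D : DyckPath n) : ℕ := D.bounce 0

def m1 (D : DyckPath n) : ℕ := D.bounce 1

/-- `d` has bounce number three: `m 2 = n` is the first bounce term equal to `n`. -/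
def BounceThree (D : DyckPath n) : Prop := D.m0 < n ∧ D.m1 < n ∧ D.bounce 2 = n

/-- A proper coloring of `inc(P(d))` with colors in `Fin N`
(vertex `v : Fin n` stands for `v + 1 ∈ {1, …, n}`). -/
def IsProperColoring (D : DyckPath n) {N : ℕ} (κ : Fin n → Fin N) : Prop :=
  ∀ u v : Fin n, D.Incomp (u.1 + 1) (v.1 + 1) → u ≠ v → κ u ≠ κ v

/-- The number of ascents of a coloring: edges `{i, j}` of `inc(P(d))` with `i < j`
and `κ i < κ j`. -/
noncomputable def ascNum (D : DyckPath n) {N : ℕ} (κ : Fin n → Fin N) : ℕ :=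
  (Finset.univ.filter fun p : Fin n × Fin n =>
    p.1 < p.2 ∧ D.Incomp (p.1.1 + 1) (p.2.1 + 1) ∧ κ p.1 < κ p.2).card

/-- The chromatic quasisymmetric polynomial `X_{inc(P(d))}(x₁, …, x_N; q)`, as a
multivariate polynomial in `x₁, …, x_N` with coefficients in `ℤ[q]`. -/
noncomputable def Xq (D : DyckPath n) (N : ℕ) : MvPolynomial (Fin N) (Polynomial ℤ) :=
  ∑ κ ∈ (Finset.univ : Finset (Fin n → Fin N)).filter (fun κ => D.IsProperColoring κ),
    MvPolynomial.C ((Polynomial.X : Polynomial ℤ) ^ D.ascNum κ) *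
      ∏ v : Fin n, MvPolynomial.X (κ v)

end DyckPath

namespace UnitInterval

open Finset

section Weights

variable {R : Type*} [CommRing R] (q : R)

/-- The `q`-integer `1 + q + ⋯ + q ^ (n - 1)`. -/
def br {S : Type*} [CommSemiring S] (q : S) (n : ℕ) : S := ∑ i ∈ range n, q ^ i

/-- The `q`-factorial. -/
def fct {S : Type*} [CommSemiring S] (q : S) (n : ℕ) : S := ∏ i ∈ range n, br q (i + 1)

/-- Weight of an edge whose smaller endpoint has colour `c` and larger endpoint colour `c'`. -/
noncomputable def wt {N : ℕ} (c c' : Fin N) : R := if c < c' then q else if c' < c then 1 else 0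

/-- The ascent generating function of the proper colourings of the graph with edge set `S`. -/
noncomputable def chi {N : ℕ} (x : Fin N → R) {n : ℕ} (S : Finset (Fin n × Fin n)) : R :=
  ∑ κ : Fin n → Fin N, (∏ p ∈ S, wt q (κ p.1) (κ p.2)) * ∏ v, x (κ v)

/-- Edge set of the unit interval graph in which `i < j` are adjacent iff `j < e i`. -/
def edges (n : ℕ) (e : ℕ → ℕ) : Finset (Fin n × Fin n) :=
  univ.filter fun p => p.1 < p.2 ∧ p.2.1 < e p.1.1

/-- The elementary symmetric polynomial evaluated at `x`. -/
noncomputable def es {N : ℕ} (x : Fin N → R) (r : ℕ) : R :=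
  ∑ S ∈ powersetCard r (univ : Finset (Fin N)), ∏ i ∈ S, x i

theorem br_zero {S : Type*} [CommSemiring S] (q : S) : br q 0 = 0 := by simp [br]

theorem br_one {S : Type*} [CommSemiring S] (q : S) : br q 1 = 1 := by simp [br]

theorem br_succ {S : Type*} [CommSemiring S] (q : S) (n : ℕ) : br q (n + 1) = 1 + q * br q n := by
  simp only [br, sum_range_succ', pow_zero, mul_sum, pow_succ']
  rw [add_comm]

theorem fct_succ {S : Type*} [CommSemiring S] (q : S) (n : ℕ) :
    fct q (n + 1) = br q (n + 1) * fct q n := by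
  rw [fct, prod_range_succ, mul_comm]; rfl

theorem fct_zero {S : Type*} [CommSemiring S] (q : S) : fct q 0 = 1 := by simp [fct]

theorem pow_eq_br (n : ℕ) : q ^ n = 1 + (q - 1) * br q n := by
  rw [br, mul_comm, geom_sum_mul]; ring

theorem map_br {S T : Type*} [CommSemiring S] [CommSemiring T] (φ : S →+* T) (q : S) (n : ℕ) :
    φ (br q n) = br (φ q) n := by simp [br]

theorem map_fct {S T : Type*} [CommSemiring S] [CommSemiring T] (φ : S →+* T) (q : S) (n : ℕ) :
    φ (fct q n) = fct (φ q) n := by simp [fct, map_br]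

theorem br_add (m n : ℕ) : br q (m + n) = br q m + br q n + (q - 1) * br q m * br q n := by
  induction n with
  | zero => simp [br_zero]
  | succ n ih => rw [← add_assoc, br_succ, ih, br_succ]; ring

variable {N : ℕ} (x : Fin N → R)

/-- The polynomial of the unit interval graph of `e`. -/
noncomputable def chie (n : ℕ) (e : ℕ → ℕ) : R := chi q x (edges n e)

theorem chie_congr {n : ℕ} {e e' : ℕ → ℕ} (h : ∀ i j, i < j → j < n → (j < e i ↔ j < e' i)) :
    chie q x n e = chie q x n e' := by
  have : edges n e = edges n e' := by
    ext ⟨i, j⟩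
    simp only [edges, mem_filter, mem_univ, true_and]
    exact and_congr_right fun hij => h i j hij j.2
  rw [chie, this, chie]

/-- Swapping the endpoints of an edge whose endpoints are twins. -/
theorem swap_sum_eq_zero [IsDomain R] [CharZero R] {n : ℕ} (T : Finset (Fin n × Fin n))
    (σ : Equiv.Perm (Fin n)) (hσ : ∀ p : Fin n × Fin n, (σ p.1, σ p.2) ∈ T ↔ p ∈ T)
    (g : (Fin n → Fin N) → R) (hg : ∀ κ, g κ + g (κ ∘ σ) = 0) :
    ∑ κ : Fin n → Fin N, g κ * ((∏ p ∈ T, wt q (κ p.1) (κ p.2)) * ∏ v, x (κ v)) = 0 := by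
  set W : (Fin n → Fin N) → R := fun κ => (∏ p ∈ T, wt q (κ p.1) (κ p.2)) * ∏ v, x (κ v) with hW
  have hWs : ∀ κ, W (κ ∘ σ) = W κ := by
    intro κ
    simp only [hW, Function.comp]
    congr 1
    · exact prod_equiv (Equiv.prodCongr σ σ) (fun p => (hσ p).symm) (fun p _ => rfl)
    · exact Equiv.prod_comp σ (fun v => x (κ v))
  have h1 : ∑ κ : Fin n → Fin N, g κ * W κ = ∑ κ : Fin n → Fin N, g (κ ∘ σ) * W κ := by
    rw [← Equiv.sum_comp (Equiv.arrowCongr σ.symm (Equiv.refl (Fin N)))]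
    refine sum_congr rfl fun κ _ => ?_
    have : (Equiv.arrowCongr σ.symm (Equiv.refl (Fin N))) κ = κ ∘ σ := by
      ext; simp [Equiv.arrowCongr]
    rw [this, hWs]
  have h2 : (2 : R) * ∑ κ : Fin n → Fin N, g κ * W κ = 0 := by
    rw [two_mul]
    nth_rewrite 2 [h1]
    rw [← sum_add_distrib]
    refine sum_eq_zero fun κ _ => ?_
    rw [← add_mul, hg, zero_mul]
  exact (mul_eq_zero.mp h2).resolve_left two_ne_zero

theorem wt_row (a b c : Fin N) :
    (wt q a b * ((1 + q) * wt q c a - q - wt q c a * wt q c b)) +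
      (wt q b a * ((1 + q) * wt q c b - q - wt q c b * wt q c a)) = 0 := by
  unfold wt
  rcases lt_trichotomy a b with h | h | h <;> rcases lt_trichotomy a c with h' | h' | h' <;>
    rcases lt_trichotomy b c with h'' | h'' | h'' <;>
    first
    | (exfalso; order)
    | (subst_vars; simp [*, lt_asymm]; try ring)

theorem wt_col (a b c : Fin N) :
    (wt q a b * ((1 + q) * wt q b c - q - wt q a c * wt q b c)) +
      (wt q b a * ((1 + q) * wt q a c - q - wt q b c * wt q a c)) = 0 := by
  unfold wt
  rcases lt_trichotomy a b with h | h | h <;> rcases lt_trichotomy a c with h' | h' | h' <;>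
    rcases lt_trichotomy b c with h'' | h'' | h'' <;>
    first
    | (exfalso; order)
    | (subst_vars; simp [*, lt_asymm]; try ring)

end Weights

section Laws

variable {R : Type*} [CommRing R] [IsDomain R] [CharZero R] (q : R) {N : ℕ} (x : Fin N → R)

theorem chi_row {n : ℕ} (T : Finset (Fin n × Fin n)) (u v i : Fin n) (huv : u ≠ v) (hiu : i ≠ u)
    (hiv : i ≠ v) (hT : ∀ p : Fin n × Fin n, (Equiv.swap u v p.1, Equiv.swap u v p.2) ∈ T ↔ p ∈ T)
    (h1 : (u, v) ∉ T) (h2 : (i, u) ∉ T) (h3 : (i, v) ∉ T) :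
    (1 + q) * chi q x (insert (i, u) (insert (u, v) T)) =
      q * chi q x (insert (u, v) T) + chi q x (insert (i, v) (insert (i, u) (insert (u, v) T))) := by
  have key := swap_sum_eq_zero q x T (Equiv.swap u v) hT
    (fun κ => wt q (κ u) (κ v) *
      ((1 + q) * wt q (κ i) (κ u) - q - wt q (κ i) (κ u) * wt q (κ i) (κ v)))
    (fun κ => by
      simp only [Function.comp, Equiv.swap_apply_left, Equiv.swap_apply_right,
        Equiv.swap_apply_of_ne_of_ne hiu hiv]
      exact wt_row q _ _ _)
  have e1 : (i, u) ∉ insert (u, v) T := by simp [h2, hiu]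
  have e2 : (i, v) ∉ insert (i, u) (insert (u, v) T) := by simp [h3, hiu, huv.symm]
  rw [← sub_eq_zero, ← key]
  simp only [chi, prod_insert e2, prod_insert e1, prod_insert h1, mul_sum, ← sum_add_distrib,
    ← sum_sub_distrib]
  refine sum_congr rfl fun κ _ => ?_
  ring

theorem chi_col {n : ℕ} (T : Finset (Fin n × Fin n)) (u v j : Fin n) (huv : u ≠ v) (hju : j ≠ u)
    (hjv : j ≠ v) (hT : ∀ p : Fin n × Fin n, (Equiv.swap u v p.1, Equiv.swap u v p.2) ∈ T ↔ p ∈ T)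
    (h1 : (u, v) ∉ T) (h2 : (u, j) ∉ T) (h3 : (v, j) ∉ T) :
    (1 + q) * chi q x (insert (v, j) (insert (u, v) T)) =
      q * chi q x (insert (u, v) T) + chi q x (insert (u, j) (insert (v, j) (insert (u, v) T))) := by
  have key := swap_sum_eq_zero q x T (Equiv.swap u v) hT
    (fun κ => wt q (κ u) (κ v) *
      ((1 + q) * wt q (κ v) (κ j) - q - wt q (κ u) (κ j) * wt q (κ v) (κ j)))
    (fun κ => by
      simp only [Function.comp, Equiv.swap_apply_left, Equiv.swap_apply_right,
        Equiv.swap_apply_of_ne_of_ne hju hjv]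
      exact wt_col q _ _ _)
  have e1 : (v, j) ∉ insert (u, v) T := by simp [h3, huv.symm]
  have e2 : (u, j) ∉ insert (v, j) (insert (u, v) T) := by simp [h2, hjv, huv]
  rw [← sub_eq_zero, ← key]
  simp only [chi, prod_insert e2, prod_insert e1, prod_insert h1, mul_sum, ← sum_add_distrib,
    ← sum_sub_distrib]
  refine sum_congr rfl fun κ _ => ?_
  ring

theorem swap_mem_iff {n : ℕ} {u : ℕ} (hu : u + 1 < n) (e : ℕ → ℕ)
    (h0 : ∀ p, p < u → e p ≠ u + 1)
    (h1 : ∀ j, u + 1 < j → j < n → (j < e u ↔ j < e (u + 1))) (p : Fin n × Fin n) :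
    (Equiv.swap (⟨u, by omega⟩ : Fin n) ⟨u + 1, hu⟩ p.1,
      Equiv.swap (⟨u, by omega⟩ : Fin n) ⟨u + 1, hu⟩ p.2) ∈
        (edges n e).erase (⟨u, by omega⟩, ⟨u + 1, hu⟩) ↔
      p ∈ (edges n e).erase (⟨u, by omega⟩, ⟨u + 1, hu⟩) := by
  obtain ⟨⟨i, hi⟩, ⟨j, hj⟩⟩ := p
  simp only [edges, mem_erase, mem_filter, mem_univ, true_and, Equiv.swap_apply_def, Fin.mk.injEq,
    Prod.mk.injEq, ne_eq, Fin.lt_def]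
  have hh0 := h0 i
  have hh1 := h1 j
  split_ifs with a b c d f g k l <;> subst_vars <;> simp only [] <;> grind

theorem chie_row {n : ℕ} (e : ℕ → ℕ) (i u : ℕ) (hi : i < u) (hu : u + 2 ≤ n)
    (h0 : ∀ p, p < u → p ≠ i → e p ≠ u + 1) (h1 : e u = e (u + 1)) (h2 : u + 2 ≤ e u) :
    (1 + q) * chie q x n (Function.update e i (u + 1)) =
      q * chie q x n (Function.update e i u) + chie q x n (Function.update e i (u + 2)) := by
  have hT := swap_mem_iff (n := n) (u := u) (by omega) (Function.update e i u) (by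
    intro p hp
    rcases eq_or_ne p i with rfl | hne
    · simp
    · simpa [hne] using h0 p hp hne) (by
    intro j hj hjn
    rw [Function.update_of_ne (by omega), Function.update_of_ne (by omega), h1])
  have := chi_row q x ((edges n (Function.update e i u)).erase (⟨u, by omega⟩, ⟨u + 1, by omega⟩))
    ⟨u, by omega⟩ ⟨u + 1, by omega⟩ ⟨i, by omega⟩ (by simp) (by simp; omega) (by simp; omega) hT
    (by simp) (by simp [edges]) (by simp [edges])
  have ee : insert ((⟨u, by omega⟩, ⟨u + 1, by omega⟩) : Fin n × Fin n)
      ((edges n (Function.update e i u)).erase (⟨u, by omega⟩, ⟨u + 1, by omega⟩)) =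
      edges n (Function.update e i u) := by
    apply insert_erase
    simp only [edges, mem_filter, mem_univ, true_and, Fin.lt_def]
    rw [Function.update_of_ne (by omega)]
    omega
  rw [ee] at this
  have e1 : insert ((⟨i, by omega⟩, ⟨u, by omega⟩) : Fin n × Fin n)
      (edges n (Function.update e i u)) = edges n (Function.update e i (u + 1)) := by
    ext ⟨⟨a, ha⟩, ⟨b, hb⟩⟩
    simp only [edges, mem_insert, mem_filter, mem_univ, true_and, Fin.lt_def, Prod.mk.injEq,
      Fin.mk.injEq, Function.update_apply]
    split_ifs <;> omega
  rw [e1] at this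
  have e2 : insert ((⟨i, by omega⟩, ⟨u + 1, by omega⟩) : Fin n × Fin n)
      (edges n (Function.update e i (u + 1))) = edges n (Function.update e i (u + 2)) := by
    ext ⟨⟨a, ha⟩, ⟨b, hb⟩⟩
    simp only [edges, mem_insert, mem_filter, mem_univ, true_and, Fin.lt_def, Prod.mk.injEq,
      Fin.mk.injEq, Function.update_apply]
    split_ifs <;> omega
  rw [e2] at this
  exact this

theorem chie_col {n : ℕ} (e e₁ e₂ : ℕ → ℕ) (u j : ℕ) (hu : u + 2 ≤ j) (hj : j < n)
    (h0 : ∀ p, p < u → e p ≠ u + 1) (hu0 : e u = j) (hu1 : e (u + 1) = j)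
    (he₁ : ∀ p, e₁ p = if p = u + 1 then j + 1 else e p)
    (he₂ : ∀ p, e₂ p = if p = u ∨ p = u + 1 then j + 1 else e p) :
    (1 + q) * chie q x n e₁ = q * chie q x n e + chie q x n e₂ := by
  have hT := swap_mem_iff (n := n) (u := u) (by omega) e h0 (by
    intro j hj hjn
    rw [hu0, hu1])
  have := chi_col q x ((edges n e).erase (⟨u, by omega⟩, ⟨u + 1, by omega⟩))
    ⟨u, by omega⟩ ⟨u + 1, by omega⟩ ⟨j, by omega⟩ (by simp) (by simp; omega) (by simp; omega) hT
    (by simp) (by simp [edges, hu0]) (by simp [edges, hu1])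
  have ee : insert ((⟨u, by omega⟩, ⟨u + 1, by omega⟩) : Fin n × Fin n)
      ((edges n e).erase (⟨u, by omega⟩, ⟨u + 1, by omega⟩)) = edges n e := by
    apply insert_erase
    simp only [edges, mem_filter, mem_univ, true_and, Fin.lt_def]
    omega
  rw [ee] at this
  have e1 : insert ((⟨u + 1, by omega⟩, ⟨j, by omega⟩) : Fin n × Fin n)
      (edges n e) = edges n e₁ := by
    ext ⟨⟨a, ha⟩, ⟨b, hb⟩⟩
    simp only [edges, mem_insert, mem_filter, mem_univ, true_and, Fin.lt_def, Prod.mk.injEq,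
      Fin.mk.injEq, he₁]
    split_ifs with h
    · subst h; omega
    · omega
  rw [e1] at this
  have e2 : insert ((⟨u, by omega⟩, ⟨j, by omega⟩) : Fin n × Fin n)
      (edges n e₁) = edges n e₂ := by
    ext ⟨⟨a, ha⟩, ⟨b, hb⟩⟩
    simp only [edges, mem_insert, mem_filter, mem_univ, true_and, Fin.lt_def, Prod.mk.injEq,
      Fin.mk.injEq, he₁, he₂]
    by_cases h : a = u
    · subst h; simp [hu0]; omega
    · by_cases h' : a = u + 1
      · subst h'; simp
      · simp [h, h']
  rw [e2] at this
  exact this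

end Laws

section Products

variable {R : Type*} [CommRing R] (q : R) {N : ℕ} (x : Fin N → R)

theorem prod_edges {n : ℕ} (e : ℕ → ℕ) (κ : Fin n → Fin N) :
    ∏ p ∈ edges n e, wt q (κ p.1) (κ p.2) =
      ∏ i, ∏ j, if i < j ∧ j.1 < e i.1 then wt q (κ i) (κ j) else 1 := by
  rw [edges, prod_filter, ← univ_product_univ, prod_product]

theorem chie_mul (m r : ℕ) (e : ℕ → ℕ) (h : ∀ i, i < m → e i ≤ m) :
    chie q x (m + r) e = chie q x m e * chie q x r (fun i => e (i + m) - m) := by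
  simp only [chie, chi, prod_edges]
  rw [sum_mul_sum, ← (Fin.appendEquiv m r).sum_comp, ← univ_product_univ, sum_product]
  refine sum_congr rfl fun κ _ => sum_congr rfl fun κ' _ => ?_
  have hc : ∀ (i : Fin m) (j : Fin r), ¬ (m + j.1 < e i.1) := fun i j => by
    have := h i i.2
    omega
  have hd : ∀ (i : Fin r) (j : Fin m), ¬ (Fin.natAdd m i < Fin.castAdd r j) := fun i j => by
    simp only [Fin.lt_def, Fin.val_natAdd, Fin.val_castAdd]
    omega
  have he : ∀ i j : Fin r, (m + j.1 < e (m + i.1)) ↔ j.1 < e (i.1 + m) - m := fun i j => by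
    rw [add_comm m i.1]
    omega
  have hf : ∀ i j : Fin m, Fin.castAdd r i < Fin.castAdd r j ↔ i < j := fun i j => Iff.rfl
  simp only [Fin.appendEquiv, Equiv.coe_fn_mk, Fin.prod_univ_add, Fin.append_left,
    Fin.append_right, Fin.val_natAdd, Fin.val_castAdd, hc, hd, and_false, false_and, if_false,
    prod_const_one, mul_one, one_mul, he, Fin.natAdd_lt_natAdd_iff, hf]
  exact mul_mul_mul_comm _ _ _ _

theorem sum_prod_erase (T : Finset (Fin N)) :
    ∑ c ∈ T, ∏ s ∈ T.erase c, wt q c s = br q T.card := by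
  induction T using Finset.induction_on_max with
  | empty => simp [br_zero]
  | insert a s ha ih =>
    have hn : a ∉ s := fun h => lt_irrefl _ (ha a h)
    rw [sum_insert hn, erase_insert hn, card_insert_of_notMem hn, br_succ, ← ih, mul_sum]
    congr 1
    · refine prod_eq_one fun c hc => ?_
      simp [wt, ha c hc, lt_asymm (ha c hc)]
    · refine sum_congr rfl fun c hc => ?_
      have hca : c ≠ a := (ha c hc).ne
      rw [erase_insert_of_ne hca.symm, prod_insert (by simp [hn])]
      simp [wt, ha c hc]

theorem prod_wt_image {n : ℕ} (c : Fin N) (κ : Fin n → Fin N) (h : Function.Injective κ) :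
    ∏ j, wt q c (κ j) = ∏ s ∈ univ.image κ, wt q c s := by
  rw [prod_image fun a _ b _ hab => h hab]

theorem prod_wt_eq_zero {n : ℕ} (κ : Fin n → Fin N) (hκ : ¬ Function.Injective κ) :
    (∏ i, ∏ j, if i < j then wt q (κ i) (κ j) else 1) = 0 := by
  simp only [Function.Injective, not_forall] at hκ
  obtain ⟨a, b, hab, hne⟩ := hκ
  rcases lt_or_gt_of_ne hne with hlt | hlt
  · refine prod_eq_zero (mem_univ a) (prod_eq_zero (mem_univ b) ?_)
    simp [hlt, hab, wt]
  · refine prod_eq_zero (mem_univ b) (prod_eq_zero (mem_univ a) ?_)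
    simp [hlt, hab, wt]

theorem sum_complete (n : ℕ) (g : Finset (Fin N) → R) :
    ∑ κ : Fin n → Fin N, (∏ i, ∏ j, if i < j then wt q (κ i) (κ j) else 1) * g (univ.image κ) =
      fct q n * ∑ S ∈ powersetCard n univ, g S := by
  induction n generalizing g with
  | zero => simp [fct]
  | succ n ih =>
    rw [← (Fin.consEquiv fun _ => Fin N).sum_comp, ← univ_product_univ, sum_product]
    have step : ∀ c : Fin N, ∑ κ : Fin n → Fin N,
        (∏ i, ∏ j, if i < j then wt q ((Fin.cons c κ : Fin (n + 1) → Fin N) i)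
          ((Fin.cons c κ : Fin (n + 1) → Fin N) j) else 1) *
          g (univ.image (Fin.cons c κ : Fin (n + 1) → Fin N)) =
        fct q n * ∑ S ∈ powersetCard n univ, (∏ s ∈ S, wt q c s) * g (insert c S) := by
      intro c
      rw [← ih fun S => (∏ s ∈ S, wt q c s) * g (insert c S)]
      refine sum_congr rfl fun κ _ => ?_
      have himg : univ.image (Fin.cons c κ : Fin (n + 1) → Fin N) =
          insert c (univ.image κ) := by
        ext y
        simp [Fin.exists_fin_succ, eq_comm]
      simp only [Fin.prod_univ_succ, Fin.cons_zero, Fin.cons_succ, if_false, one_mul,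
        Fin.succ_pos, if_true, Fin.succ_lt_succ_iff, not_lt_zero, himg]
      by_cases hκ : Function.Injective κ
      · rw [prod_wt_image q c κ hκ]
        ring
      · rw [prod_wt_eq_zero q κ hκ]
        simp
    have h2 : ∑ c : Fin N, ∑ S ∈ powersetCard n univ, (∏ s ∈ S, wt q c s) * g (insert c S) =
        ∑ T ∈ powersetCard (n + 1) univ, ∑ c ∈ T, (∏ s ∈ T.erase c, wt q c s) * g T := by
      rw [← sum_product', sum_sigma']
      refine (sum_subset (filter_subset
        (fun p : Fin N × Finset (Fin N) => p.1 ∉ p.2) _) ?_).symm.trans ?_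
      · intro p _ hp'
        simp only [mem_filter, not_and, not_not] at hp'
        have : p.1 ∈ p.2 := hp' (by assumption)
        rw [prod_eq_zero this (by simp [wt]), zero_mul]
      · refine sum_bij' (fun p _ => ⟨insert p.1 p.2, p.1⟩) (fun t _ => (t.2, t.1.erase t.2))
          ?_ ?_ ?_ ?_ ?_
        · intro p hp
          simp only [mem_filter, mem_product, mem_univ, true_and, mem_powersetCard,
            subset_univ] at hp
          simp [mem_powersetCard, card_insert_of_notMem hp.2, hp.1]
        · intro t ht
          simp only [mem_sigma, mem_powersetCard, subset_univ, true_and] at ht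
          simp [mem_powersetCard, card_erase_of_mem ht.2, ht.1]
        · intro p hp
          simp only [mem_filter] at hp
          simp [erase_insert hp.2]
        · intro t ht
          simp only [mem_sigma] at ht
          simp [insert_erase ht.2]
        · intro p hp
          simp only [mem_filter] at hp
          simp [erase_insert hp.2]
    have h3 : ∀ c : Fin N, ∑ κ : Fin n → Fin N,
        (∏ i, ∏ j, if i < j then wt q (((Fin.consEquiv fun _ => Fin N) (c, κ)) i)
          (((Fin.consEquiv fun _ => Fin N) (c, κ)) j) else 1) *
          g (univ.image ((Fin.consEquiv fun _ => Fin N) (c, κ))) =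
        fct q n * ∑ S ∈ powersetCard n univ, (∏ s ∈ S, wt q c s) * g (insert c S) := step
    rw [sum_congr rfl fun c _ => h3 c, ← mul_sum, h2, fct_succ, mul_comm (br q (n + 1)), mul_assoc]
    congr 1
    rw [mul_sum]
    refine sum_congr rfl fun T hT => ?_
    rw [← sum_mul, sum_prod_erase, (mem_powersetCard.mp hT).2]

theorem chie_complete (n : ℕ) (e : ℕ → ℕ) (h : ∀ i, i < n → n ≤ e i) :
    chie q x n e = fct q n * es x n := by
  rw [es, ← sum_complete q n fun S => ∏ i ∈ S, x i]
  simp only [chie, chi, prod_edges]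
  refine sum_congr rfl fun κ _ => ?_
  have h1 : (∏ i, ∏ j, if i < j ∧ j.1 < e i.1 then wt q (κ i) (κ j) else 1) =
      ∏ i, ∏ j, if i < j then wt q (κ i) (κ j) else 1 := by
    refine prod_congr rfl fun i _ => prod_congr rfl fun j _ => ?_
    have := h i i.2
    have := j.2
    simp [show j.1 < e i.1 by omega]
  rw [h1]
  by_cases hκ : Function.Injective κ
  · rw [prod_image fun a _ b _ hab => hκ hab]
  · rw [prod_wt_eq_zero q κ hκ, zero_mul, zero_mul]

end Products

section Families

variable {R : Type*} [CommRing R] (q : R) {N : ℕ} (x : Fin N → R)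

/-- The path `(a, b, n, …, n)`. -/
noncomputable def JJ (n a b : ℕ) : R :=
  chie q x n fun i => if i = 0 then a else if i = 1 then b else n

/-- The path `(a, b, c, n, …, n)`. -/
noncomputable def LL (n a b c : ℕ) : R :=
  chie q x n fun i => if i = 0 then a else if i = 1 then b else if i = 2 then c else n

/-- The path `(a, n - 1, …, n - 1, n, …, n)` with `k - 1` entries `n - 1`. -/
noncomputable def FF (n a k : ℕ) : R :=
  chie q x n fun i => if i = 0 then a else if i < k then n - 1 else n

/-- The path `(a, b, n - 1, …, n - 1, n, …, n)` with `k - 2` entries `n - 1` after `b`. -/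
noncomputable def XX (n a b k : ℕ) : R :=
  chie q x n fun i => if i = 0 then a else if i = 1 then b else if i < k then n - 1 else n

theorem XX_two (n a b : ℕ) : XX q x n a b 2 = JJ q x n a b := by
  apply chie_congr
  intro i j hij hj
  grind

theorem FF_one (n a : ℕ) : FF q x n a 1 = JJ q x n a n := by
  apply chie_congr
  intro i j hij hj
  grind

theorem FF_two (n a : ℕ) : FF q x n a 2 = JJ q x n a (n - 1) := by
  apply chie_congr
  intro i j hij hj
  grind

theorem FF_eq_XX (n a k : ℕ) (hk : 2 ≤ k) : FF q x n a k = XX q x n a (n - 1) k := by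
  apply chie_congr
  intro i j hij hj
  grind

theorem LL_top (n a b : ℕ) : LL q x n a b n = JJ q x n a b := by
  apply chie_congr
  intro i j hij hj
  grind

theorem LL_pred (n a b : ℕ) : LL q x n a b (n - 1) = XX q x n a b 3 := by
  apply chie_congr
  intro i j hij hj
  grind

theorem JJ_top (n : ℕ) : JJ q x n n n = fct q n * es x n := by
  apply chie_complete
  intro i hi
  grind

theorem chie_one (e : ℕ → ℕ) : chie q x 1 e = es x 1 := by
  rw [chie_congr (e' := fun _ => 1), chie_complete]
  · simp [fct, br_one]
  · intros; omega
  · intros; omega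

theorem XX_last (n a b : ℕ) (ha : a ≤ n) (hb : b ≤ n) :
    XX q x (n + 1) a b n = es x 1 * JJ q x n a b := by
  rw [XX, chie_mul q x n 1, chie_one, mul_comm]
  · congr 1
    apply chie_congr
    intro i j hij hj
    grind
  · intro i hi
    grind

theorem JJ_one (n : ℕ) : JJ q x (n + 1) 1 (n + 1) = fct q n * (es x n * es x 1) := by
  rw [JJ, add_comm n 1, chie_mul q x 1 n, chie_one, chie_complete]
  · ring
  · intro i hi
    grind
  · intro i hi
    grind

theorem JJ_two_two (n : ℕ) : JJ q x (n + 2) 2 2 = (1 + q) * fct q n * (es x n * es x 2) := by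
  rw [JJ, add_comm n 2, chie_mul q x 2 n, chie_complete, chie_complete]
  · rw [fct_succ, fct_succ, fct_zero, br_succ, br_succ, br_zero]; ring
  · intro i hi
    grind
  · intro i hi
    grind
  · intro i hi
    grind

theorem LL_three (n : ℕ) : LL q x (n + 3) 3 3 3 =
    (1 + q) * (1 + q + q ^ 2) * fct q n * (es x n * es x 3) := by
  rw [LL, add_comm n 3, chie_mul q x 3 n, chie_complete, chie_complete]
  · simp only [fct_succ, fct_zero, br_succ, br_zero]; ring
  · intro i hi
    grind
  · intro i hi
    grind
  · intro i hi
    grind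

end Families

section Recurrences

variable {R : Type*} [CommRing R] [IsDomain R] [CharZero R] (q : R) {N : ℕ} (x : Fin N → R)

theorem chie_row' {n : ℕ} (e e₁ e₂ : ℕ → ℕ) (i u : ℕ) (hi : i < u) (hu : u + 2 ≤ n)
    (h0 : ∀ p, p < u → p ≠ i → e p ≠ u + 1) (h1 : e u = e (u + 1)) (h2 : u + 2 ≤ e u)
    (he : e i = u) (he₁ : ∀ p, e₁ p = if p = i then u + 1 else e p)
    (he₂ : ∀ p, e₂ p = if p = i then u + 2 else e p) :
    (1 + q) * chie q x n e₁ = q * chie q x n e + chie q x n e₂ := by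
  have := chie_row q x (n := n) e i u hi hu h0 h1 h2
  have e0 : Function.update e i u = e := by rw [← he, Function.update_eq_self]
  have e1 : Function.update e i (u + 1) = e₁ := by
    funext p; rw [Function.update_apply, he₁]
  have e2 : Function.update e i (u + 2) = e₂ := by
    funext p; rw [Function.update_apply, he₂]
  rwa [e0, e1, e2] at this

theorem XX_b {n a k u : ℕ} (hu : 2 ≤ u) (ha : a ≠ u + 1) (hk : u + 1 < k ∨ k ≤ u)
    (hn : u + 2 ≤ n - 1) :
    (1 + q) * XX q x n a (u + 1) k = q * XX q x n a u k + XX q x n a (u + 2) k := by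
  apply chie_row' q x _ _ _ 1 u <;> grind

theorem XX_a {n b k u : ℕ} (hu : 2 ≤ u) (hb : u + 2 ≤ b) (hk : u + 2 ≤ k)
    (hn : k ≤ n - 1) :
    (1 + q) * XX q x n (u + 1) b k = q * XX q x n u b k + XX q x n (u + 2) b k := by
  apply chie_row' q x _ _ _ 0 u <;> grind

theorem XX_k {n a b u : ℕ} (hu : 2 ≤ u) (ha : a ≠ u + 1) (hb : b ≠ u + 1) (hn : u + 3 ≤ n) :
    (1 + q) * XX q x n a b (u + 1) = q * XX q x n a b (u + 2) + XX q x n a b u := by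
  apply chie_col q x _ _ _ u (n - 1) <;> grind

theorem XX_ab {n a k : ℕ} (ha : 2 ≤ a) (hn : a < n) :
    (1 + q) * XX q x n a (a + 1) k = q * XX q x n a a k + XX q x n (a + 1) (a + 1) k := by
  apply chie_col q x _ _ _ 0 a <;> grind

theorem JJ_b {n a u : ℕ} (hu : 2 ≤ u) (ha : a ≠ u + 1) (hn : u + 2 ≤ n) :
    (1 + q) * JJ q x n a (u + 1) = q * JJ q x n a u + JJ q x n a (u + 2) := by
  apply chie_row' q x _ _ _ 1 u <;> grind

theorem JJ_a {n b u : ℕ} (hu : 2 ≤ u) (hb : u + 2 ≤ b) (hn : b ≤ n) :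
    (1 + q) * JJ q x n (u + 1) b = q * JJ q x n u b + JJ q x n (u + 2) b := by
  apply chie_row' q x _ _ _ 0 u <;> grind

theorem JJ_a_top {n u : ℕ} (hu : 1 ≤ u) (hn : u + 2 ≤ n) :
    (1 + q) * JJ q x n (u + 1) n = q * JJ q x n u n + JJ q x n (u + 2) n := by
  apply chie_row' q x _ _ _ 0 u <;> grind

theorem JJ_ab {n a : ℕ} (ha : 2 ≤ a) (hn : a < n) :
    (1 + q) * JJ q x n a (a + 1) = q * JJ q x n a a + JJ q x n (a + 1) (a + 1) := by
  apply chie_col q x _ _ _ 0 a <;> grind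

theorem LL_c {n a b u : ℕ} (hu : 3 ≤ u) (ha : a ≠ u + 1) (hb : b ≠ u + 1) (hn : u + 2 ≤ n) :
    (1 + q) * LL q x n a b (u + 1) = q * LL q x n a b u + LL q x n a b (u + 2) := by
  apply chie_row' q x _ _ _ 2 u <;> grind

theorem FF_k {n a u : ℕ} (hu : 1 ≤ u) (ha : a ≠ u + 1) (hn : u + 3 ≤ n) :
    (1 + q) * FF q x n a (u + 1) = q * FF q x n a (u + 2) + FF q x n a u := by
  apply chie_col q x _ _ _ u (n - 1) <;> grind

end Recurrences

section Interpolation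

variable {R : Type*} [CommRing R] {q : R}

theorem law_eq_br {f : ℕ → R} {s t : ℕ}
    (h : ∀ u, s ≤ u → u + 2 ≤ t → (1 + q) * f (u + 1) = q * f u + f (u + 2)) (hs : f s = 0)
    (i : ℕ) (hi : s + i ≤ t) : f (s + i) = br q i * f (s + 1) := by
  induction i using Nat.strong_induction_on with
  | _ i ih =>
    match i with
    | 0 => simp [hs, br_zero]
    | 1 => simp [br_one]
    | i + 2 =>
      have h1 := h (s + i) (by omega) (by omega)
      have h2 := ih i (by omega) (by omega)
      have h3 := ih (i + 1) (by omega) (by omega)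
      rw [← add_assoc] at h3 ⊢
      rw [h2, h3] at h1
      rw [br_succ] at *
      rw [br_succ]
      linear_combination -h1

/-- A sequence satisfying the linear recurrence vanishes if its first two terms do. -/
theorem extrapolate {f : ℕ → R} {s t : ℕ}
    (h : ∀ u, s ≤ u → u + 2 ≤ t → (1 + q) * f (u + 1) = q * f u + f (u + 2)) (hs : f s = 0)
    (hs' : s + 1 ≤ t → f (s + 1) = 0) (u : ℕ) (hu : s ≤ u) (hut : u ≤ t) : f u = 0 := by
  rcases eq_or_lt_of_le hu with rfl | hsu
  · exact hs
  · have := law_eq_br h hs (u - s) (by omega)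
    rwa [show s + (u - s) = u by omega, hs' (by omega), mul_zero] at this

variable [IsDomain R]

/-- A sequence satisfying the linear recurrence vanishes if it vanishes at both ends. -/
theorem interpolate {f : ℕ → R} {s t : ℕ} (hq : ∀ m, br q (m + 1) ≠ 0)
    (h : ∀ u, s ≤ u → u + 2 ≤ t → (1 + q) * f (u + 1) = q * f u + f (u + 2)) (hs : f s = 0)
    (ht : f t = 0) (u : ℕ) (hu : s ≤ u) (hut : u ≤ t) : f u = 0 := by
  rcases eq_or_lt_of_le (hu.trans hut) with rfl | hst
  · rw [show u = s by omega, hs]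
  · have h1 := law_eq_br h hs (t - s) (by omega)
    rw [show s + (t - s) = t by omega, ht] at h1
    obtain ⟨m, hm⟩ : ∃ m, t - s = m + 1 := ⟨t - s - 1, by omega⟩
    rw [hm] at h1
    have h2 : f (s + 1) = 0 := (mul_eq_zero.mp h1.symm).resolve_left (hq m)
    have h3 := law_eq_br h hs (u - s) (by omega)
    rw [show s + (u - s) = u by omega, h2, mul_zero] at h3
    exact h3

/-- Decreasing version of `interpolate`. -/
theorem interpolate_rev {f : ℕ → R} {s t : ℕ} (hq : ∀ m, br q (m + 1) ≠ 0)
    (h : ∀ u, s ≤ u → u + 2 ≤ t → (1 + q) * f (u + 1) = q * f (u + 2) + f u) (hs : f s = 0)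
    (ht : f t = 0) (u : ℕ) (hu : s ≤ u) (hut : u ≤ t) : f u = 0 := by
  have := interpolate (f := fun i => f (t - i)) (s := 0) (t := t - s) hq ?_ (by simpa) ?_ (t - u)
    (by omega) (by omega)
  · simpa [show t - (t - u) = u by omega] using this
  · intro v _ hv
    have := h (t - (v + 2)) (by omega) (by omega)
    rw [show t - (v + 2) + 1 = t - (v + 1) by omega, show t - (v + 2) + 2 = t - v by omega] at this
    exact this
  · simpa [show t - (t - s) = s by omega] using hs

/-- Decreasing version of `extrapolate`. -/
theorem extrapolate_rev {f : ℕ → R} {s t : ℕ} (hq : q ≠ 0)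
    (h : ∀ u, s ≤ u → u + 2 ≤ t → (1 + q) * f (u + 1) = q * f (u + 2) + f u) (hs : f s = 0)
    (hs' : s + 1 ≤ t → f (s + 1) = 0) (u : ℕ) (hu : s ≤ u) (hut : u ≤ t) : f u = 0 := by
  induction u using Nat.strong_induction_on with
  | _ u ih =>
    rcases Nat.lt_or_ge u (s + 2) with h2 | h2
    · rcases eq_or_lt_of_le hu with rfl | h3
      · exact hs
      · rw [show u = s + 1 by omega]
        exact hs' (by omega)
    · obtain ⟨v, rfl⟩ : ∃ v, u = v + 2 := ⟨u - 2, by omega⟩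
      have h4 := h v (by omega) (by omega)
      rw [ih v (by omega) (by omega) (by omega), ih (v + 1) (by omega) (by omega) (by omega)] at h4
      simpa [hq] using h4.symm

end Interpolation

section Affine

variable {R : Type*} [CommRing R] {q : R}

theorem law_sub {f : ℕ → R} {s₀ s t : ℕ} (hs₀ : s₀ ≤ s) (c : R) (Φ : R → R)
    (hΦ : ∀ P, (1 + q) * Φ (1 + q * P) = q * Φ P + Φ (1 + q * (1 + q * P)))
    (h : ∀ u, s ≤ u → u + 2 ≤ t → (1 + q) * f (u + 1) = q * f u + f (u + 2))
    (u : ℕ) (hu : s ≤ u) (hut : u + 2 ≤ t) :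
    (1 + q) * (c * f (u + 1) - Φ (br q (u + 1 - s₀))) =
      q * (c * f u - Φ (br q (u - s₀))) + (c * f (u + 2) - Φ (br q (u + 2 - s₀))) := by
  rw [show u + 1 - s₀ = u - s₀ + 1 by omega, show u + 2 - s₀ = u - s₀ + 1 + 1 by omega, br_succ,
    br_succ, br_succ]
  linear_combination c * h u hu hut - hΦ (br q (u - s₀))

theorem law_sub_rev {f : ℕ → R} {s t t₀ : ℕ} (ht₀ : t ≤ t₀) (c : R) (Φ : R → R)
    (hΦ : ∀ P, (1 + q) * Φ (1 + q * P) = q * Φ P + Φ (1 + q * (1 + q * P)))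
    (h : ∀ u, s ≤ u → u + 2 ≤ t → (1 + q) * f (u + 1) = q * f (u + 2) + f u)
    (u : ℕ) (hu : s ≤ u) (hut : u + 2 ≤ t) :
    (1 + q) * (c * f (u + 1) - Φ (br q (t₀ - (u + 1)))) =
      q * (c * f (u + 2) - Φ (br q (t₀ - (u + 2)))) + (c * f u - Φ (br q (t₀ - u))) := by
  rw [show t₀ - (u + 1) = t₀ - (u + 2) + 1 by omega, show t₀ - u = t₀ - (u + 2) + 1 + 1 by omega,
    br_succ, br_succ, br_succ]
  linear_combination c * h u hu hut - hΦ (br q (t₀ - (u + 2)))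

theorem extrapolate_affine {f : ℕ → R} {s₀ s t : ℕ} (hs₀ : s₀ ≤ s) (c : R) (Φ : R → R)
    (hΦ : ∀ P, (1 + q) * Φ (1 + q * P) = q * Φ P + Φ (1 + q * (1 + q * P)))
    (h : ∀ u, s ≤ u → u + 2 ≤ t → (1 + q) * f (u + 1) = q * f u + f (u + 2))
    (hs : c * f s = Φ (br q (s - s₀))) (hs' : s + 1 ≤ t → c * f (s + 1) = Φ (br q (s + 1 - s₀)))
    (u : ℕ) (hu : s ≤ u) (hut : u ≤ t) : c * f u = Φ (br q (u - s₀)) :=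
  sub_eq_zero.mp <| extrapolate (f := fun u => c * f u - Φ (br q (u - s₀)))
    (law_sub hs₀ c Φ hΦ h) (sub_eq_zero.mpr hs) (fun h => sub_eq_zero.mpr (hs' h)) u hu hut

variable [IsDomain R]

theorem interpolate_affine (hq : ∀ m, br q (m + 1) ≠ 0) {f : ℕ → R} {s₀ s t : ℕ} (hs₀ : s₀ ≤ s)
    (c : R) (Φ : R → R)
    (hΦ : ∀ P, (1 + q) * Φ (1 + q * P) = q * Φ P + Φ (1 + q * (1 + q * P)))
    (h : ∀ u, s ≤ u → u + 2 ≤ t → (1 + q) * f (u + 1) = q * f u + f (u + 2))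
    (hs : c * f s = Φ (br q (s - s₀))) (ht : c * f t = Φ (br q (t - s₀)))
    (u : ℕ) (hu : s ≤ u) (hut : u ≤ t) : c * f u = Φ (br q (u - s₀)) :=
  sub_eq_zero.mp <| interpolate (f := fun u => c * f u - Φ (br q (u - s₀))) hq
    (law_sub hs₀ c Φ hΦ h) (sub_eq_zero.mpr hs) (sub_eq_zero.mpr ht) u hu hut

theorem interpolate_affine_rev (hq : ∀ m, br q (m + 1) ≠ 0) {f : ℕ → R} {s t t₀ : ℕ}
    (ht₀ : t ≤ t₀) (c : R) (Φ : R → R)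
    (hΦ : ∀ P, (1 + q) * Φ (1 + q * P) = q * Φ P + Φ (1 + q * (1 + q * P)))
    (h : ∀ u, s ≤ u → u + 2 ≤ t → (1 + q) * f (u + 1) = q * f (u + 2) + f u)
    (hs : c * f s = Φ (br q (t₀ - s))) (ht : c * f t = Φ (br q (t₀ - t)))
    (u : ℕ) (hu : s ≤ u) (hut : u ≤ t) : c * f u = Φ (br q (t₀ - u)) :=
  sub_eq_zero.mp <| interpolate_rev (f := fun u => c * f u - Φ (br q (t₀ - u))) hq
    (law_sub_rev ht₀ c Φ hΦ h) (sub_eq_zero.mpr hs) (sub_eq_zero.mpr ht) u hu hut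

theorem extrapolate_affine_rev (hq : q ≠ 0) {f : ℕ → R} {s t t₀ : ℕ} (ht₀ : t ≤ t₀) (c : R)
    (Φ : R → R)
    (hΦ : ∀ P, (1 + q) * Φ (1 + q * P) = q * Φ P + Φ (1 + q * (1 + q * P)))
    (h : ∀ u, s ≤ u → u + 2 ≤ t → (1 + q) * f (u + 1) = q * f (u + 2) + f u)
    (hs : c * f s = Φ (br q (t₀ - s))) (hs' : s + 1 ≤ t → c * f (s + 1) = Φ (br q (t₀ - (s + 1))))
    (u : ℕ) (hu : s ≤ u) (hut : u ≤ t) : c * f u = Φ (br q (t₀ - u)) :=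
  sub_eq_zero.mp <| extrapolate_rev (f := fun u => c * f u - Φ (br q (t₀ - u))) hq
    (law_sub_rev ht₀ c Φ hΦ h) (sub_eq_zero.mpr hs) (fun h => sub_eq_zero.mpr (hs' h)) u hu hut

end Affine

section TwoRows

variable {R : Type*} [CommRing R] [IsDomain R] [CharZero R] {q : R} {N : ℕ} (x : Fin N → R)

theorem JJ_top_eq (hq : ∀ m, br q (m + 1) ≠ 0) (m a : ℕ) (h1 : 1 ≤ a) (h2 : a ≤ m + 2) :
    JJ q x (m + 2) a (m + 2) = fct q m * ((br q (m + 1) - br q (a - 1)) * (es x (m + 1) * es x 1) +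
      br q (a - 1) * br q (m + 2) * es x (m + 2)) := by
  rw [← one_mul (JJ q x (m + 2) a (m + 2))]
  refine interpolate_affine hq (f := fun a => JJ q x (m + 2) a (m + 2)) (s₀ := 1) (s := 1)
    (t := m + 2) le_rfl 1 (fun u => fct q m * ((br q (m + 1) - u) * (es x (m + 1) * es x 1) +
      u * br q (m + 2) * es x (m + 2))) ?_ ?_ ?_ ?_ a h1 h2
  · intro P; ring
  · intro u hu hn
    exact JJ_a_top q x hu hn
  · simp only [JJ_one, fct_succ, Nat.sub_self, br_zero]; ring
  · simp only [JJ_top, fct_succ, show m + 2 - 1 = m + 1 by omega]; ring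

theorem JJ_two_eq (hq : ∀ m, br q (m + 1) ≠ 0) (m b : ℕ) (h1 : 2 ≤ b) (h2 : b ≤ m + 3) :
    JJ q x (m + 3) 2 b = fct q m *
      ((1 + q) * (br q (m + 1) - br q (b - 2)) * (es x (m + 1) * es x 2) +
      q * br q (m + 1) * br q (b - 2) * (es x (m + 2) * es x 1) +
      br q (m + 3) * br q (b - 2) * es x (m + 3)) := by
  rw [← one_mul (JJ q x (m + 3) 2 b)]
  refine interpolate_affine hq (f := fun b => JJ q x (m + 3) 2 b) (s₀ := 2) (s := 2)
    (t := m + 3) le_rfl 1 (fun B => fct q m *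
      ((1 + q) * (br q (m + 1) - B) * (es x (m + 1) * es x 2) +
      q * br q (m + 1) * B * (es x (m + 2) * es x 1) +
      br q (m + 3) * B * es x (m + 3))) ?_ ?_ ?_ ?_ b h1 h2
  · intro P; ring
  · intro u hu hn
    exact JJ_b q x hu (by omega) hn
  · rw [show m + 3 = (m + 1) + 2 by ring, JJ_two_two, fct_succ, Nat.sub_self, br_zero]; ring
  · rw [show m + 3 = (m + 1) + 2 by ring, JJ_top_eq x hq _ _ (by omega) (by omega)]
    simp only [fct_succ, br_succ, br_zero, show m + 1 + 2 - 2 = m + 1 by omega,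
      show 2 - 1 = 0 + 1 by omega]
    ring

/-- The closed form of `JJ q x (m + 4) a b` in terms of `P = [a - 2]`, `B = [b - 2]`, `ν = [m]`. -/
def PhiJ {R : Type*} [CommRing R] (q ν f E0 E1 E2 P B : R) : R :=
  f * ((1 + q * (1 + q * (1 + q * (1 + q * ν)))) * (1 + q * ν) * (1 + q * P) * B * E0 +
    (1 + q * (1 + q * ν)) * (q * (1 + q * ν) * (q * P + B) - (1 + q) * P * (B - 1)) * E1 +
    (1 + q) * (1 + q * ν - P) * (1 + q * (1 + q * ν) - B) * E2)

theorem JJ_eq (hq : ∀ m, br q (m + 1) ≠ 0) (m a b : ℕ) (h1 : 2 ≤ a) (hab : a ≤ b)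
    (h2 : b ≤ m + 4) :
    JJ q x (m + 4) a b = PhiJ q (br q m) (fct q m) (es x (m + 4)) (es x (m + 3) * es x 1)
      (es x (m + 2) * es x 2) (br q (a - 2)) (br q (b - 2)) := by
  have two : ∀ b, 2 ≤ b → b ≤ m + 4 → JJ q x (m + 4) 2 b = PhiJ q (br q m) (fct q m)
      (es x (m + 4)) (es x (m + 3) * es x 1) (es x (m + 2) * es x 2) 0 (br q (b - 2)) := by
    intro b h1 h2
    rw [show m + 4 = (m + 1) + 3 by ring, JJ_two_eq x hq _ _ h1 (by omega)]
    simp only [fct_succ, br_succ, PhiJ]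
    ring
  have three : ∀ b, 3 ≤ b → b ≤ m + 4 → JJ q x (m + 4) 3 b = PhiJ q (br q m) (fct q m)
      (es x (m + 4)) (es x (m + 3) * es x 1) (es x (m + 2) * es x 2) 1 (br q (b - 2)) := by
    intro b h1 h2
    rw [← one_mul (JJ q x (m + 4) 3 b)]
    refine interpolate_affine hq (f := fun b => JJ q x (m + 4) 3 b) (s₀ := 2) (s := 3)
      (t := m + 4) (by omega) 1 (fun B => PhiJ q (br q m) (fct q m)
        (es x (m + 4)) (es x (m + 3) * es x 1) (es x (m + 2) * es x 2) 1 B) ?_ ?_ ?_ ?_ b h1 h2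
    · intro P; simp only [PhiJ]; ring
    · intro u hu hn
      exact JJ_b q x (by omega) (by omega) hn
    · have := JJ_ab q x (n := m + 4) (a := 2) le_rfl (by omega)
      rw [two 3 (by omega) (by omega), two 2 (by omega) (by omega)] at this
      simp only [PhiJ, show 3 - 2 = 0 + 1 by omega, Nat.sub_self, br_succ, br_zero] at this ⊢
      linear_combination -this
    · rw [show m + 4 = (m + 2) + 2 by ring, JJ_top_eq x hq _ _ (by omega) (by omega)]
      simp only [fct_succ, br_succ, br_zero, show m + 2 + 2 - 2 = m + 2 by omega,
        show 3 - 1 = 0 + 1 + 1 by omega, PhiJ]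
      ring
  rw [← one_mul (JJ q x (m + 4) a b)]
  refine extrapolate_affine (f := fun a => JJ q x (m + 4) a b) (s₀ := 2) (s := 2)
      (t := b) le_rfl 1 (fun P => PhiJ q (br q m) (fct q m)
        (es x (m + 4)) (es x (m + 3) * es x 1) (es x (m + 2) * es x 2) P (br q (b - 2)))
        ?_ ?_ ?_ ?_ a h1 hab
  · intro P; simp only [PhiJ]; ring
  · intro u hu hn
    exact JJ_a q x hu hn h2
  · simpa [br_zero] using two b (by omega) h2
  · intro h3
    simpa [br_one] using three b h3 h2

/-- The closed form of `FF q x (m + 4) a k` in terms of `P = [a - 2]`, `t = [m + 3 - k]`,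
`ν = [m]`. -/
def PhiF {R : Type*} [CommRing R] (q ν f E0 E1 E2 P t : R) : R :=
  f * ((1 + q * (1 + q * (1 + q * (1 + q * ν)))) * (1 + q * ν) * (1 + q * P) * t * E0 +
    (1 + q * (1 + q * ν)) * (q * (1 + q * ν) * t + P * ((1 + q) * (1 + q * (1 + q * ν)) -
      q * (1 + q * ν) - (1 + q) * t)) * E1 +
    (1 + q) * (1 + q * ν - P) * (1 + q * (1 + q * ν) - t) * E2)

theorem FF_eq (hq0 : q ≠ 0) (hq : ∀ m, br q (m + 1) ≠ 0) (m a k : ℕ) (h1 : 1 ≤ k) (hka : k ≤ a)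
    (ha : 2 ≤ a) (h2 : a ≤ m + 3) :
    FF q x (m + 4) a k = PhiF q (br q m) (fct q m) (es x (m + 4)) (es x (m + 3) * es x 1)
      (es x (m + 2) * es x 2) (br q (a - 2)) (br q (m + 3 - k)) := by
  rw [← one_mul (FF q x (m + 4) a k)]
  refine extrapolate_affine_rev hq0 (f := fun k => FF q x (m + 4) a k) (t₀ := m + 3) (s := 1)
      (t := a) h2 1 (fun t => PhiF q (br q m) (fct q m)
        (es x (m + 4)) (es x (m + 3) * es x 1) (es x (m + 2) * es x 2) (br q (a - 2)) t)
        ?_ ?_ ?_ ?_ k h1 hka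
  · intro P; simp only [PhiF]; ring
  · intro u hu hn
    exact FF_k q x hu (by omega) (by omega)
  · rw [FF_one, show m + 4 = (m + 2) + 2 by ring, JJ_top_eq x hq _ _ (by omega) (by omega)]
    simp only [fct_succ, br_succ, PhiF, show m + 3 - 1 = m + 2 by omega,
        show a - 1 = a - 2 + 1 by omega]
    ring
  · intro _
    rw [FF_two, JJ_eq x hq _ _ _ ha (by omega) (by omega)]
    simp only [br_succ, PhiF, PhiJ, show m + 4 - 1 - 2 = m + 1 by omega,
      show m + 3 - (1 + 1) = m + 1 by omega]
    ring

end TwoRows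

section ClosedForms

variable {R : Type*} [CommRing R]

/-- The closed form of `q * XX q x (s + 5) a b k` for `a ≤ b ≤ k`, in terms of `P = [a - 2]`,
`B = [b - 2]`, `t = [s + 4 - k]`, `ν = [s]`, `f = [s]!`, `g = [s - 1]!`. -/
def Phi3 (q ν f g E0 E1 E2 E11 E3 E21 P B t : R) : R :=
  let c1 := 1 + q * ν
  let c2 := 1 + q * c1
  let c3 := 1 + q * c2
  let c4 := 1 + q * c3
  let c5 := 1 + q * c4
  let L := q * P + B
  let H := q * P * (B - 1)
  q * c5 * (1 + q * P) * B * (c1 * f) * t * E0 +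
  (q * (f * (q * c1 * c3 * t + c4 * (c1 - t))) * L +
    f * (q * c4 * c1 - (c5 + q * c3 + q * c1) * t) * H) * E1 +
  (q * ((1 + q) * c3 * (c1 * f) * t +
      (q * (1 + q) * c2 * (c1 * f) * t - (1 + q) * c3 * (c1 * f) * t) * L) +
    (1 + q) * c1 * g * t * (1 + (1 + (q - 1) * c1) + (1 + (q - 1) * c2)) * H) * E2 +
  (q * (q * c2 * f * (c1 - t)) * L - (1 + q) * c2 * f * (1 + (q - 1) * t) * H) * E11 +
  (q * ((1 + (q - 1) * c1) * (1 + q + q ^ 2) * f * t) * L -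
    (1 + q + q ^ 2) * g * (1 + (q - 1) * ν) * (1 + q) * t * H) * E3 +
  (q * ((1 + q) * (c1 * f) * (c2 - t) +
      (q * (1 + q) * (c1 * f) * c1 + ((1 + (q - 1) * c2) * f - q * (1 + q) * (c1 * f)) * t -
        (1 + q) * (c1 * f) * (c2 - t)) * L) +
    (1 + q) * f * (1 + (q - 1) * t) * H) * E21

/-- The closed form of `q * XX q x (s + 5) a b k` for `a ≤ k ≤ b`. -/
def Phi2 (q ν f g E0 E1 E2 E11 E3 E21 P B t : R) : R :=
  let c1 := 1 + q * ν
  let c2 := 1 + q * c1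
  let c3 := 1 + q * c2
  let c4 := 1 + q * c3
  let u := 1 + q * P
  Phi3 q ν f g E0 E1 E2 E11 E3 E21 P B t + (B + t + (q - 1) * B * t - c2) *
    (c4 * u * f * E1 - (1 + q) * c1 * c3 * P * g * E2 + q * c2 * u * f * E11 -
      (1 + q + q ^ 2) * c2 * (f - g * P) * E3 + q ^ 2 * (ν - P) * f * E21)

variable (q : R) {N : ℕ} (x : Fin N → R)

/-- `Phi3` at the elementary symmetric polynomials. -/
noncomputable def PP3 (s : ℕ) (g P B t : R) : R :=
  Phi3 q (br q s) (fct q s) g (es x (s + 5)) (es x (s + 4) * es x 1) (es x (s + 3) * es x 2)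
    (es x (s + 3) * es x 1 ^ 2) (es x (s + 2) * es x 3) (es x (s + 2) * (es x 2 * es x 1)) P B t

/-- `Phi2` at the elementary symmetric polynomials. -/
noncomputable def PP2 (s : ℕ) (g P B t : R) : R :=
  Phi2 q (br q s) (fct q s) g (es x (s + 5)) (es x (s + 4) * es x 1) (es x (s + 3) * es x 2)
    (es x (s + 3) * es x 1 ^ 2) (es x (s + 2) * es x 3) (es x (s + 2) * (es x 2 * es x 1)) P B t

theorem PP3_P (s : ℕ) (g B t P : R) : (1 + q) * PP3 q x s g (1 + q * P) B t =
    q * PP3 q x s g P B t + PP3 q x s g (1 + q * (1 + q * P)) B t := by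
  simp only [PP3, Phi3]; ring

theorem PP3_B (s : ℕ) (g P t B : R) : (1 + q) * PP3 q x s g P (1 + q * B) t =
    q * PP3 q x s g P B t + PP3 q x s g P (1 + q * (1 + q * B)) t := by
  simp only [PP3, Phi3]; ring

theorem PP3_t (s : ℕ) (g P B t : R) : (1 + q) * PP3 q x s g P B (1 + q * t) =
    q * PP3 q x s g P B t + PP3 q x s g P B (1 + q * (1 + q * t)) := by
  simp only [PP3, Phi3]; ring

theorem PP2_P (s : ℕ) (g B t P : R) : (1 + q) * PP2 q x s g (1 + q * P) B t =
    q * PP2 q x s g P B t + PP2 q x s g (1 + q * (1 + q * P)) B t := by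
  simp only [PP2, Phi2, Phi3]; ring

theorem PP2_B (s : ℕ) (g P t B : R) : (1 + q) * PP2 q x s g P (1 + q * B) t =
    q * PP2 q x s g P B t + PP2 q x s g P (1 + q * (1 + q * B)) t := by
  simp only [PP2, Phi2, Phi3]; ring

theorem PP2_t (s : ℕ) (g P B t : R) : (1 + q) * PP2 q x s g P B (1 + q * t) =
    q * PP2 q x s g P B t + PP2 q x s g P B (1 + q * (1 + q * t)) := by
  simp only [PP2, Phi2, Phi3]; ring

theorem PP2_eq_PP3 (s k : ℕ) (g P : R) (h1 : 2 ≤ k) (h2 : k ≤ s + 4) :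
    PP2 q x s g P (br q (k - 2)) (br q (s + 4 - k)) =
      PP3 q x s g P (br q (k - 2)) (br q (s + 4 - k)) := by
  have := br_add q (k - 2) (s + 4 - k)
  rw [show k - 2 + (s + 4 - k) = s + 1 + 1 by omega, br_succ, br_succ] at this
  rw [PP2, Phi2, ← this, PP3]
  ring

theorem one_add_ne_zero {q : R} (hq : ∀ m, br q (m + 1) ≠ 0) : 1 + q ≠ 0 := by
  simpa [br_succ, br_zero] using hq 1

end ClosedForms

section FirstRowTwo

variable {R : Type*} [CommRing R] [IsDomain R] [CharZero R] {q : R} {N : ℕ} (x : Fin N → R)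

theorem XX_two_two (hq : ∀ m, br q (m + 1) ≠ 0) (s : ℕ) (g : R) (k : ℕ) (h1 : 2 ≤ k)
    (h2 : k ≤ s + 4) : q * XX q x (s + 5) 2 2 k = PP3 q x s g 0 0 (br q (s + 4 - k)) := by
  refine interpolate_affine_rev hq (f := fun k => XX q x (s + 5) 2 2 k) (t₀ := s + 4) (s := 2)
    (t := s + 4) le_rfl q (PP3 q x s g 0 0) (PP3_t q x s g 0 0) ?_ ?_ ?_ k h1 h2
  · intro u hu hn
    exact XX_k q x hu (by omega) (by omega) (by omega)
  · rw [XX_two, show s + 5 = (s + 3) + 2 by ring, JJ_two_two]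
    simp only [PP3, Phi3, fct_succ, br_succ, show s + 4 - 2 = s + 2 by omega]
    ring
  · rw [XX_last q x _ _ _ (by omega) (by omega), show s + 4 = (s + 2) + 2 by ring, JJ_two_two]
    simp only [PP3, Phi3, fct_succ, br_succ, Nat.sub_self, br_zero]
    ring

theorem XX_two_top (hq : ∀ m, br q (m + 1) ≠ 0) (s : ℕ) (g : R) (k : ℕ) (h1 : 2 ≤ k)
    (h2 : k ≤ s + 4) :
    q * XX q x (s + 5) 2 (s + 4) k = PP2 q x s g 0 (br q (s + 2)) (br q (s + 4 - k)) := by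
  refine interpolate_affine_rev hq (f := fun k => XX q x (s + 5) 2 (s + 4) k) (t₀ := s + 4)
    (s := 2) (t := s + 4) le_rfl q (PP2 q x s g 0 (br q (s + 2))) (PP2_t q x s g 0 _)
    ?_ ?_ ?_ k h1 h2
  · intro u hu hn
    exact XX_k q x hu (by omega) (by omega) (by omega)
  · rw [XX_two, show s + 5 = (s + 2) + 3 by ring, JJ_two_eq x hq _ _ (by omega) (by omega)]
    simp only [PP2, Phi2, Phi3, fct_succ, br_succ, show s + 4 - 2 = s + 2 by omega]
    ring
  · rw [XX_last q x _ _ _ (by omega) (by omega), show s + 4 = (s + 2) + 2 by ring,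
      JJ_top_eq x hq _ _ (by omega) (by omega)]
    simp only [PP2, Phi2, Phi3, fct_succ, br_succ, Nat.sub_self, br_zero, show 2 - 1 = 0 + 1 by omega]
    ring

theorem XX_three_three_three (hq : ∀ m, br q (m + 1) ≠ 0) (s : ℕ) (g : R) :
    q * XX q x (s + 5) 3 3 3 = PP3 q x s g 1 1 (br q (s + 1)) := by
  have h := interpolate_affine hq (f := fun c => LL q x (s + 5) 3 3 c) (s₀ := 3) (s := 3)
    (t := s + 5) le_rfl (br q (s + 2))
    (fun u => (br q (s + 2) - u) * LL q x (s + 5) 3 3 3 + u * LL q x (s + 5) 3 3 (s + 5))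
    (fun P => by ring) (fun u hu hn => LL_c q x hu (by omega) (by omega) hn)
    (by simp [br_zero]) (by simp) (s + 4) (by omega) (by omega)
  have h4 : LL q x (s + 5) 3 3 (s + 4) = XX q x (s + 5) 3 3 3 := LL_pred q x (s + 5) 3 3
  simp only [h4, LL_top, show s + 4 - 3 = s + 1 by omega] at h
  rw [show s + 5 = (s + 2) + 3 by ring, LL_three, show s + 2 + 3 = s + 1 + 4 by ring,
    JJ_eq x hq _ _ _ (by omega) (by omega) (by omega)] at h
  refine mul_left_cancel₀ (hq (s + 1)) ?_
  rw [show s + 5 = s + 1 + 4 by ring]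
  simp only [PP3, Phi3, PhiJ, fct_succ, br_succ, br_zero, show 3 - 2 = 0 + 1 by omega] at h ⊢
  linear_combination q * h

theorem XX_three_three (hq : ∀ m, br q (m + 1) ≠ 0) (s : ℕ) (g : R) (k : ℕ) (h1 : 3 ≤ k)
    (h2 : k ≤ s + 4) : q * XX q x (s + 5) 3 3 k = PP3 q x s g 1 1 (br q (s + 4 - k)) := by
  refine interpolate_affine_rev hq (f := fun k => XX q x (s + 5) 3 3 k) (t₀ := s + 4) (s := 3)
    (t := s + 4) le_rfl q (PP3 q x s g 1 1) (PP3_t q x s g 1 1) ?_ ?_ ?_ k h1 h2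
  · intro u hu hn
    exact XX_k q x (by omega) (by omega) (by omega) (by omega)
  · rw [show s + 4 - 3 = s + 1 by omega]
    exact XX_three_three_three x hq s g
  · rw [XX_last q x _ _ _ (by omega) (by omega), JJ_eq x hq _ _ _ (by omega) (by omega) (by omega)]
    simp only [PP3, Phi3, PhiJ, br_succ, Nat.sub_self, br_zero,
      show 3 - 2 = 0 + 1 by omega]
    ring

theorem XX_two_three (hq : ∀ m, br q (m + 1) ≠ 0) (s : ℕ) (g : R) (k : ℕ) (h1 : 3 ≤ k)
    (h2 : k ≤ s + 4) : q * XX q x (s + 5) 2 3 k = PP3 q x s g 0 1 (br q (s + 4 - k)) := by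
  have h := XX_ab q x (n := s + 5) (a := 2) (k := k) le_rfl (by omega)
  have h22 := XX_two_two x hq s g k (by omega) h2
  have h33 := XX_three_three x hq s g k h1 h2
  refine mul_left_cancel₀ (one_add_ne_zero hq) ?_
  simp only [PP3, Phi3] at h22 h33 ⊢
  linear_combination q * h + q * h22 + h33

theorem XX_two_lo (hq : ∀ m, br q (m + 1) ≠ 0) (s : ℕ) (g : R) (b k : ℕ) (h1 : 2 ≤ b) (hbk : b ≤ k)
    (h3 : 3 ≤ k) (h2 : k ≤ s + 4) :
    q * XX q x (s + 5) 2 b k = PP3 q x s g 0 (br q (b - 2)) (br q (s + 4 - k)) := by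
  refine extrapolate_affine (f := fun b => XX q x (s + 5) 2 b k) (s₀ := 2) (s := 2)
    (t := k) le_rfl q (fun B => PP3 q x s g 0 B (br q (s + 4 - k)))
    (fun B => PP3_B q x s g 0 (br q (s + 4 - k)) B) ?_ ?_ ?_ b h1 hbk
  · intro u hu hn
    exact XX_b q x hu (by omega) (by omega) (by omega)
  · rw [Nat.sub_self, br_zero]
    exact XX_two_two x hq s g k (by omega) h2
  · intro _
    rw [show 2 + 1 - 2 = 1 by omega, br_one]
    exact XX_two_three x hq s g k h3 h2

theorem XX_two_hi (hq : ∀ m, br q (m + 1) ≠ 0) (s : ℕ) (g : R) (b k : ℕ) (h3 : 3 ≤ k) (hbk : k ≤ b)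
    (h2 : b ≤ s + 4) :
    q * XX q x (s + 5) 2 b k = PP2 q x s g 0 (br q (b - 2)) (br q (s + 4 - k)) := by
  refine interpolate_affine hq (f := fun b => XX q x (s + 5) 2 b k) (s₀ := 2) (s := k)
    (t := s + 4) (by omega) q (fun B => PP2 q x s g 0 B (br q (s + 4 - k)))
    (fun B => PP2_B q x s g 0 (br q (s + 4 - k)) B) ?_ ?_ ?_ b hbk h2
  · intro u hu hn
    exact XX_b q x (by omega) (by omega) (by omega) (by omega)
  · rw [PP2_eq_PP3 q x _ _ _ _ (by omega) (by omega)]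
    exact XX_two_lo x hq s g k k (by omega) le_rfl h3 (by omega)
  · exact XX_two_top x hq s g k (by omega) (by omega)

end FirstRowTwo

section General

variable {R : Type*} [CommRing R] [IsDomain R] [CharZero R] {q : R} {N : ℕ} (x : Fin N → R)

theorem XX_three_top (hq0 : q ≠ 0) (hq : ∀ m, br q (m + 1) ≠ 0) (s : ℕ) (g : R)
    (hg : fct q s = br q s * g) (k : ℕ) (h1 : 3 ≤ k) (h2 : k ≤ s + 4) :
    q * XX q x (s + 5) 3 (s + 4) k = PP2 q x s g 1 (br q (s + 2)) (br q (s + 4 - k)) := by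
  refine interpolate_affine_rev hq (f := fun k => XX q x (s + 5) 3 (s + 4) k) (t₀ := s + 4)
    (s := 3) (t := s + 4) le_rfl q (PP2 q x s g 1 (br q (s + 2))) (PP2_t q x s g 1 _)
    ?_ ?_ ?_ k h1 h2
  · intro u hu hn
    exact XX_k q x (by omega) (by omega) (by omega) (by omega)
  · have h : FF q x (s + 1 + 4) 3 3 = XX q x (s + 5) 3 (s + 4) 3 :=
      FF_eq_XX q x (s + 5) 3 3 (by omega)
    rw [← h, FF_eq x hq0 hq _ _ _ (by omega) (by omega) (by omega) (by omega)]
    simp only [PP2, Phi2, Phi3, PhiF, fct_succ, br_succ, show s + 4 - 3 = s + 1 by omega,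
      show 3 - 2 = 0 + 1 by omega, br_zero, hg]
    ring
  · rw [XX_last q x _ _ _ (by omega) (by omega), show s + 4 = (s + 2) + 2 by ring,
      JJ_top_eq x hq _ _ (by omega) (by omega)]
    simp only [PP2, Phi2, Phi3, fct_succ, br_succ, Nat.sub_self, br_zero,
      show 3 - 1 = 0 + 1 + 1 by omega, hg]
    ring

theorem XX_four_four (hq0 : q ≠ 0) (hq : ∀ m, br q (m + 1) ≠ 0) (s : ℕ) (g : R)
    (hg : fct q s = br q s * g) (k : ℕ) (h1 : 4 ≤ k) (h2 : k ≤ s + 4) :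
    q * XX q x (s + 5) 4 4 k = PP3 q x s g (1 + q) (1 + q) (br q (s + 4 - k)) := by
  refine interpolate_affine_rev hq (f := fun k => XX q x (s + 5) 4 4 k) (t₀ := s + 4)
    (s := 4) (t := s + 4) le_rfl q (PP3 q x s g (1 + q) (1 + q)) (PP3_t q x s g _ _)
    ?_ ?_ ?_ k h1 h2
  · intro u hu hn
    exact XX_k q x (by omega) (by omega) (by omega) (by omega)
  · have h343 := interpolate_affine hq (f := fun b => XX q x (s + 5) 3 b 3) (s₀ := 2) (s := 3)
      (t := s + 4) (by omega) q (fun B => PP2 q x s g 1 B (br q (s + 1)))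
      (fun B => PP2_B q x s g 1 (br q (s + 1)) B)
      (fun u hu hn => XX_b q x (by omega) (by omega) (by omega) (by omega))
      (by
        have := PP2_eq_PP3 q x s 3 g 1 (by omega) (by omega)
        rw [show s + 4 - 3 = s + 1 by omega] at this
        rw [this, XX_three_three_three x hq s g, show 3 - 2 = 1 by omega, br_one])
      (by
        rw [XX_three_top x hq0 hq s g hg 3 le_rfl (by omega)]
        rw [show s + 4 - 3 = s + 1 by omega, show s + 4 - 2 = s + 2 by omega])
      4 (by omega) (by omega)
    have h333 := XX_three_three_three x hq s g
    have h443 := XX_ab q x (n := s + 5) (a := 3) (k := 3) (by omega) (by omega)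
    have h444 := XX_k q x (n := s + 5) (a := 4) (b := 4) (u := 2) le_rfl (by omega) (by omega)
      (by omega)
    rw [XX_two, show s + 5 = s + 1 + 4 by ring,
      JJ_eq x hq _ _ _ (by omega) (by omega) (by omega)] at h444
    rw [show s + 5 = s + 1 + 4 by ring] at h343 h333 h443 ⊢
    refine mul_left_cancel₀ hq0 ?_
    simp only [PP3, PP2, Phi2, Phi3, PhiJ, fct_succ, br_succ, show s + 4 - 4 = s by omega,
      show 4 - 2 = 0 + 1 + 1 by omega, br_zero, hg] at h343 h333 h443 h444 ⊢
    linear_combination (1 + q) * ((1 + q) * h343 - q * h333 - q * h443) - q * h444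
  · rw [XX_last q x _ _ _ (by omega) (by omega), JJ_eq x hq _ _ _ (by omega) (by omega) (by omega)]
    simp only [PP3, Phi3, PhiJ, br_succ, Nat.sub_self, br_zero,
      show 4 - 2 = 0 + 1 + 1 by omega, hg]
    ring

theorem XX_three_lo (hq0 : q ≠ 0) (hq : ∀ m, br q (m + 1) ≠ 0) (s : ℕ) (g : R)
    (hg : fct q s = br q s * g) (b k : ℕ) (h1 : 3 ≤ b) (hbk : b ≤ k) (h2 : k ≤ s + 4) :
    q * XX q x (s + 5) 3 b k = PP3 q x s g 1 (br q (b - 2)) (br q (s + 4 - k)) := by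
  refine extrapolate_affine (f := fun b => XX q x (s + 5) 3 b k) (s₀ := 2) (s := 3)
    (t := k) (by omega) q (fun B => PP3 q x s g 1 B (br q (s + 4 - k)))
    (fun B => PP3_B q x s g 1 (br q (s + 4 - k)) B) ?_ ?_ ?_ b h1 hbk
  · intro u hu hn
    exact XX_b q x (by omega) (by omega) (by omega) (by omega)
  · rw [show 3 - 2 = 1 by omega, br_one]
    exact XX_three_three x hq s g k (by omega) h2
  · intro h4
    rw [show 3 + 1 - 2 = 0 + 1 + 1 by omega, br_succ, br_succ, br_zero]
    have h := XX_ab q x (n := s + 5) (a := 3) (k := k) (by omega) (by omega)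
    have h33 := XX_three_three x hq s g k (by omega) h2
    have h44 := XX_four_four x hq0 hq s g hg k h4 h2
    refine mul_left_cancel₀ (one_add_ne_zero hq) ?_
    simp only [PP3, Phi3] at h33 h44 ⊢
    linear_combination q * h + q * h33 + h44

theorem XX_three_hi (hq0 : q ≠ 0) (hq : ∀ m, br q (m + 1) ≠ 0) (s : ℕ) (g : R)
    (hg : fct q s = br q s * g) (b k : ℕ) (h3 : 3 ≤ k) (hbk : k ≤ b) (h2 : b ≤ s + 4) :
    q * XX q x (s + 5) 3 b k = PP2 q x s g 1 (br q (b - 2)) (br q (s + 4 - k)) := by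
  refine interpolate_affine hq (f := fun b => XX q x (s + 5) 3 b k) (s₀ := 2) (s := k)
    (t := s + 4) (by omega) q (fun B => PP2 q x s g 1 B (br q (s + 4 - k)))
    (fun B => PP2_B q x s g 1 (br q (s + 4 - k)) B) ?_ ?_ ?_ b hbk h2
  · intro u hu hn
    exact XX_b q x (by omega) (by omega) (by omega) (by omega)
  · rw [PP2_eq_PP3 q x _ _ _ _ (by omega) (by omega)]
    exact XX_three_lo x hq0 hq s g hg k k h3 le_rfl (by omega)
  · exact XX_three_top x hq0 hq s g hg k (by omega) (by omega)

theorem XX_lo (hq0 : q ≠ 0) (hq : ∀ m, br q (m + 1) ≠ 0) (s : ℕ) (g : R)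
    (hg : fct q s = br q s * g) (a b k : ℕ) (h1 : 2 ≤ a) (hab : a ≤ b) (h3 : 3 ≤ b) (hbk : b ≤ k)
    (h2 : k ≤ s + 4) :
    q * XX q x (s + 5) a b k = PP3 q x s g (br q (a - 2)) (br q (b - 2)) (br q (s + 4 - k)) := by
  refine extrapolate_affine (f := fun a => XX q x (s + 5) a b k) (s₀ := 2) (s := 2)
    (t := b) le_rfl q (fun P => PP3 q x s g P (br q (b - 2)) (br q (s + 4 - k)))
    (fun P => PP3_P q x s g (br q (b - 2)) (br q (s + 4 - k)) P) ?_ ?_ ?_ a h1 hab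
  · intro u hu hn
    exact XX_a q x hu hn (by omega) h2
  · rw [Nat.sub_self, br_zero]
    exact XX_two_lo x hq s g b k (by omega) hbk (by omega) h2
  · intro _
    rw [show 2 + 1 - 2 = 1 by omega, br_one]
    exact XX_three_lo x hq0 hq s g hg b k h3 hbk h2

theorem XX_hi (hq0 : q ≠ 0) (hq : ∀ m, br q (m + 1) ≠ 0) (s : ℕ) (g : R)
    (hg : fct q s = br q s * g) (a b k : ℕ) (h1 : 2 ≤ a) (hak : a ≤ k) (h3 : 3 ≤ k) (hbk : k ≤ b)
    (h2 : b ≤ s + 4) :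
    q * XX q x (s + 5) a b k = PP2 q x s g (br q (a - 2)) (br q (b - 2)) (br q (s + 4 - k)) := by
  refine extrapolate_affine (f := fun a => XX q x (s + 5) a b k) (s₀ := 2) (s := 2)
    (t := k) le_rfl q (fun P => PP2 q x s g P (br q (b - 2)) (br q (s + 4 - k)))
    (fun P => PP2_P q x s g (br q (b - 2)) (br q (s + 4 - k)) P) ?_ ?_ ?_ a h1 hak
  · intro u hu hn
    exact XX_a q x hu (by omega) hn (by omega)
  · rw [Nat.sub_self, br_zero]
    exact XX_two_hi x hq s g b k h3 hbk h2
  · intro _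
    rw [show 2 + 1 - 2 = 1 by omega, br_one]
    exact XX_three_hi x hq0 hq s g hg b k h3 hbk h2

end General

section BracketIdentities

variable {R : Type*} [CommRing R] (q : R)

theorem pow_mul_br {i j l : ℕ} (h : i + j = l) : q ^ i * br q j = br q l - br q i := by
  rw [← h, br_add, pow_eq_br]; ring

theorem br_eq_of_add {i j l : ℕ} (h : i + j = l) :
    br q l = br q i + (1 + (q - 1) * br q i) * br q j := by
  rw [← h, br_add]; ring

theorem br_eq_succ {i j : ℕ} (h : j = i + 1) : br q j = 1 + q * br q i := by
  rw [h, br_succ]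

end BracketIdentities

section PositiveForms

set_option linter.unusedVariables false

variable {R : Type*} [CommRing R] [IsDomain R] [CharZero R] {q : R} {N : ℕ} (x : Fin N → R)

theorem JJ_top_pos (hq : ∀ m, br q (m + 1) ≠ 0) (m a : ℕ) (h1 : 1 ≤ a) (h2 : a ≤ m + 2) :
    JJ q x (m + 2) a (m + 2) =
      fct q m * (q ^ (a - 1) * br q (m + 2 - a)) * (es x (m + 1) * es x 1) +
      fct q m * br q (a - 1) * br q (m + 2) * es x (m + 2) := by
  rw [JJ_top_eq x hq m a h1 h2, pow_mul_br q (show a - 1 + (m + 2 - a) = m + 1 by omega)]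
  ring

theorem JJ_two_pos (hq : ∀ m, br q (m + 1) ≠ 0) (m b : ℕ) (h1 : 2 ≤ b) (h2 : b ≤ m + 3) :
    JJ q x (m + 3) 2 b =
      br q 2 * fct q m * (q ^ (b - 2) * br q (m + 3 - b)) * (es x (m + 1) * es x 2) +
      fct q m * q * br q (m + 1) * br q (b - 2) * (es x (m + 2) * es x 1) +
      fct q m * br q (m + 3) * br q (b - 2) * es x (m + 3) := by
  rw [JJ_two_eq x hq m b h1 h2, pow_mul_br q (show b - 2 + (m + 3 - b) = m + 1 by omega)]
  simp only [br_succ, br_zero]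
  ring

theorem JJ_pos (hq : ∀ m, br q (m + 1) ≠ 0) (m a b : ℕ) (h1 : 2 ≤ a) (hab : a ≤ b)
    (ha : a ≤ m + 3) (h2 : b ≤ m + 4) : JJ q x (m + 4) a b =
      br q (m + 4) * br q (a - 1) * br q (b - 2) * fct q (m + 1) * es x (m + 4) +
      br q (m + 2) * fct q m * (q ^ (a - 1) * br q (m + 3 - a) * br q (b - 2) +
        q ^ (b - 2) * br q (m + 5 - b) * br q (a - 2)) * (es x (m + 3) * es x 1) +
      br q 2 * fct q m * (q ^ (a - 2) * br q (m + 3 - a) * (q ^ (b - 2) * br q (m + 4 - b))) *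
        (es x (m + 2) * es x 2) := by
  rw [JJ_eq x hq m a b h1 hab h2, pow_mul_br q (show a - 1 + (m + 3 - a) = m + 2 by omega),
    pow_mul_br q (show b - 2 + (m + 5 - b) = m + 3 by omega),
    pow_mul_br q (show a - 2 + (m + 3 - a) = m + 1 by omega),
    pow_mul_br q (show b - 2 + (m + 4 - b) = m + 2 by omega)]
  simp only [PhiJ, br_succ, br_zero, fct_succ, br_eq_succ q (show a - 1 = a - 2 + 1 by omega)]
  ring

theorem FF_pos (hq0 : q ≠ 0) (hq : ∀ m, br q (m + 1) ≠ 0) (m a k : ℕ) (h1 : 1 ≤ k) (hka : k ≤ a)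
    (ha : 2 ≤ a) (h2 : a ≤ m + 3) : FF q x (m + 4) a k =
      br q (m + 4) * fct q (m + 1) * br q (a - 1) * br q (m + 3 - k) * es x (m + 4) +
      br q (m + 2) * fct q m * (q ^ (m + 3 - k) * br q (k - 1) * br q (a - 2) +
        q ^ a * br q (m + 3 - a) * br q (m + 2 - k) + q ^ (a - 1) * br q (m + 1)) *
        (es x (m + 3) * es x 1) +
      br q 2 * fct q m * (q ^ (a - 2) * br q (m + 3 - a) * (q ^ (m + 3 - k) * br q (k - 1))) *
        (es x (m + 2) * es x 2) := by
  rw [FF_eq x hq0 hq m a k h1 hka ha h2, pow_mul_br q (show m + 3 - k + (k - 1) = m + 2 by omega),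
    pow_mul_br q (show a + (m + 3 - a) = m + 3 by omega),
    pow_mul_br q (show a - 2 + (m + 3 - a) = m + 1 by omega), pow_eq_br q (a - 1)]
  rcases (hka.trans h2).lt_or_eq with hk | rfl
  · simp only [PhiF, br_succ, br_zero, fct_succ, br_eq_succ q (show a - 1 = a - 2 + 1 by omega),
      br_eq_succ q (show a = a - 1 + 1 by omega),
      br_eq_succ q (show m + 3 - k = m + 2 - k + 1 by omega)]
    ring
  · obtain rfl : a = m + 3 := by omega
    simp only [PhiF, br_succ, br_zero, fct_succ, Nat.sub_self, show m + 3 - 1 = m + 2 by omega,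
      show m + 3 - 2 = m + 1 by omega]
    ring

theorem XX_two_two_pos (hq0 : q ≠ 0) (hq : ∀ m, br q (m + 1) ≠ 0) (s k : ℕ) (h3 : 3 ≤ k)
    (h2 : k ≤ s + 3) : XX q x (s + 5) 2 2 k =
      br q 2 * br q (s + 3) * fct q (s + 1) * br q (s + 4 - k) * (es x (s + 3) * es x 2) +
      br q 2 * fct q (s + 1) * (q ^ (s + 4 - k) * br q (k - 2)) *
        (es x (s + 2) * (es x 2 * es x 1)) := by
  refine mul_left_cancel₀ hq0 ?_
  rw [XX_two_two x hq s 0 k (by omega) (by omega),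
    pow_mul_br q (show s + 4 - k + (k - 2) = s + 2 by omega)]
  simp only [PP3, Phi3, br_succ, br_zero, fct_succ]
  ring

theorem XX_two_lo_pos (hq0 : q ≠ 0) (hq : ∀ m, br q (m + 1) ≠ 0) (s b k : ℕ) (h3 : 3 ≤ b)
    (hbk : b ≤ k) (h2 : k ≤ s + 3) : XX q x (s + 5) 2 b k =
      br q (s + 5) * br q (b - 2) * fct q (s + 1) * br q (s + 4 - k) * es x (s + 5) +
      fct q s * (br q (s + 4) * br q (b - 2) * (q ^ (s + 4 - k) * br q (k - 3)) +
        br q (s + 4 - k) * br q (b - 3) * br q (s + 2) * (q * br q (s + 3)) +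
        br q (s + 4 - k) * br q (s + 3) * (q ^ (b - 2) * br q (s + 4 - b))) *
        (es x (s + 4) * es x 1) +
      br q 2 * fct q (s + 1) * br q (s + 4 - k) * (q ^ (b - 2) * br q (s + 5 - b)) *
        (es x (s + 3) * es x 2) +
      fct q s * br q (s + 2) *
        (q * br q (b - 3) * (q * (q ^ (s + 4 - k) * br q (k - 3))) +
          q * (q ^ (s + 4 - k) * br q (k - 3))) * (es x (s + 3) * es x 1 ^ 2) +
      br q 3 * fct q s * q ^ (s + 1) * br q (s + 4 - k) * br q (b - 2) *
        (es x (s + 2) * es x 3) +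
      fct q s * (br q 2 * q ^ (s + 4 - k) * br q (s + 1) * (q ^ (b - 2) * br q (k - b)) +
        q ^ (s + 2) * br q (s + 4 - k) * br q (b - 2)) * (es x (s + 2) * (es x 2 * es x 1)) := by
  refine mul_left_cancel₀ hq0 ?_
  rw [XX_two_lo x hq s 0 b k (by omega) hbk (by omega) (by omega),
    pow_mul_br q (show s + 4 - k + (k - 3) = s + 1 by omega),
    pow_mul_br q (show b - 2 + (s + 4 - b) = s + 2 by omega),
    pow_mul_br q (show b - 2 + (s + 5 - b) = s + 3 by omega),
    pow_mul_br q (show b - 2 + (k - b) = k - 2 by omega),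
    pow_eq_br q (s + 4 - k), pow_eq_br q (s + 1), pow_eq_br q (s + 2)]
  simp only [PP3, Phi3, br_succ, br_zero, fct_succ, br_eq_succ q (show b - 2 = b - 3 + 1 by omega),
    br_eq_succ q (show k - 2 = k - 3 + 1 by omega),
    br_eq_succ q (show s + 4 - k = s + 3 - k + 1 by omega),
    br_eq_of_add q (show k - 3 + (s + 3 - k) = s by omega)]
  ring

theorem XX_two_hi_pos (hq0 : q ≠ 0) (hq : ∀ m, br q (m + 1) ≠ 0) (s b k : ℕ) (h3 : 3 ≤ k)
    (hk : k ≤ s + 3) (hbk : k ≤ b) (h2 : b ≤ s + 4) : XX q x (s + 5) 2 b k =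
      br q (s + 5) * br q (b - 2) * fct q (s + 1) * br q (s + 4 - k) * es x (s + 5) +
      fct q s * (br q (s + 4) * br q (b - 3) * (q ^ (s + 4 - k) * br q (k - 2)) +
        br q (s + 4 - k) * br q (b - 3) * br q (s + 2) * (q * br q (s + 3)) +
        br q (s + 4 - k) * br q (s + 3) * (q ^ (b - 2) * br q (s + 4 - b))) *
        (es x (s + 4) * es x 1) +
      br q 2 * fct q (s + 1) * (q ^ (b - 2) * br q (s + 4 - b) * br q (s + 5 - k) +
        q ^ (s + 4 - k) * (q ^ (k - 2) * br q (b - k))) * (es x (s + 3) * es x 2) +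
      fct q s * br q (s + 2) * (q * br q (b - 3) * (q ^ (s + 4 - k) * br q (k - 2))) *
        (es x (s + 3) * es x 1 ^ 2) +
      br q 3 * fct q s * q ^ (s + 1) * (q ^ (b - k) * br q (s + 4 - b)) * br q (k - 2) *
        (es x (s + 2) * es x 3) +
      fct q s * q ^ (s + 2) * (q ^ (b - k) * br q (s + 4 - b)) * br q (k - 2) *
        (es x (s + 2) * (es x 2 * es x 1)) := by
  refine mul_left_cancel₀ hq0 ?_
  rw [XX_two_hi x hq s 0 b k (by omega) hbk (by omega),
    pow_mul_br q (show s + 4 - k + (k - 2) = s + 2 by omega),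
    pow_mul_br q (show b - 2 + (s + 4 - b) = s + 2 by omega),
    pow_mul_br q (show b - k + (s + 4 - b) = s + 4 - k by omega),
    pow_mul_br q (show k - 2 + (b - k) = b - 2 by omega),
    pow_eq_br q (s + 4 - k), pow_eq_br q (s + 1), pow_eq_br q (s + 2)]
  simp only [PP2, Phi2, Phi3, br_succ, br_zero, fct_succ,
    br_eq_succ q (show b - 2 = b - 3 + 1 by omega),
    br_eq_succ q (show k - 2 = k - 3 + 1 by omega),
    br_eq_succ q (show s + 5 - k = s + 4 - k + 1 by omega),
    br_eq_succ q (show s + 4 - k = s + 3 - k + 1 by omega),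
    br_eq_of_add q (show k - 3 + (b - k) = b - 3 by omega),
    br_eq_of_add q (show k - 3 + (s + 3 - k) = s by omega)]
  ring

theorem XX_lo_pos (hq0 : q ≠ 0) (hq : ∀ m, br q (m + 1) ≠ 0) (s a b k : ℕ) (h3 : 3 ≤ a)
    (hab : a ≤ b) (hbk : b ≤ k) (hak : a < k) (h2 : k ≤ s + 3) : XX q x (s + 5) a b k =
      br q (s + 5) * br q (a - 1) * br q (b - 2) * fct q (s + 1) * br q (s + 4 - k) *
        es x (s + 5) +
      fct q s * (br q (s + 4) * br q (a - 1) * br q (b - 2) * (q ^ (s + 4 - k) * br q (k - 3)) +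
        br q (s + 4 - k) * br q (b - 3) * br q (s + 2) * (q ^ (a - 1) * br q (s + 5 - a)) +
        br q (s + 4 - k) * br q (s + 3) * br q (a - 1) * (q ^ (b - 2) * br q (s + 4 - b))) *
        (es x (s + 4) * es x 1) +
      br q 2 * br q (s + 1) * fct q (s - 1) * br q (s + 4 - k) *
        (q * ((q ^ (a - 2) * br q (s + 3 - a)) * (q ^ (b - 3) * br q (s + 3 - b)) +
          q ^ (s + 1) * br q s + q ^ s * br q (b - 3) +
          q ^ (s + 1) * br q 2 * br q (a - 2) * br q (b - 3))) * (es x (s + 3) * es x 2) +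
      fct q s * br q (s + 2) *
        (q ^ (s + 4 - k) * (q ^ (b - 2) * br q (k - b)) * br q (a - 2) +
          q * q ^ (s + 4 - k) * (q ^ (a - 1) * br q (k - 1 - a)) * br q (b - 3) +
          q ^ (a - 1) * (q ^ (s + 4 - k) * br q (k - 3))) * (es x (s + 3) * es x 1 ^ 2) +
      br q 3 * fct q (s - 1) * br q (s + 4 - k) * q ^ s *
        (q ^ (a - 1) * br q (s + 2 - a) * br q (b - 2) +
          q ^ (b - 2) * br q (s + 4 - b) * br q (a - 2)) * (es x (s + 2) * es x 3) +
      fct q s * (br q 2 * q ^ (s + 4 - k) * (q ^ (a - 2) * br q (s + 3 - a)) *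
          (q ^ (b - 2) * br q (k - b)) +
        q ^ (s + 2) * br q (s + 4 - k) * (q ^ (a - 2) * br q (b - a))) *
        (es x (s + 2) * (es x 2 * es x 1)) := by
  have hg : fct q s = br q s * fct q (s - 1) := by
    rw [← Nat.sub_add_cancel (show 1 ≤ s by omega), fct_succ, Nat.add_sub_cancel]
  refine mul_left_cancel₀ hq0 ?_
  rw [XX_lo x hq0 hq s _ hg a b k (by omega) hab (by omega) hbk (by omega),
    pow_mul_br q (show s + 4 - k + (k - 3) = s + 1 by omega),
    pow_mul_br q (show a - 1 + (s + 5 - a) = s + 4 by omega),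
    pow_mul_br q (show b - 2 + (s + 4 - b) = s + 2 by omega),
    pow_mul_br q (show a - 2 + (s + 3 - a) = s + 1 by omega),
    pow_mul_br q (show b - 3 + (s + 3 - b) = s by omega),
    pow_mul_br q (show b - 2 + (k - b) = k - 2 by omega),
    pow_mul_br q (show a - 1 + (k - 1 - a) = k - 2 by omega),
    pow_mul_br q (show a - 1 + (s + 2 - a) = s + 1 by omega),
    pow_mul_br q (show a - 2 + (b - a) = b - 2 by omega),
    pow_eq_br q (s + 4 - k), pow_eq_br q (s + 1), pow_eq_br q (s + 2), pow_eq_br q s,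
    pow_eq_br q (a - 1)]
  simp only [PP3, Phi3, br_succ, br_zero, fct_succ, hg,
    br_eq_succ q (show b - 2 = b - 3 + 1 by omega),
    br_eq_succ q (show a - 1 = a - 2 + 1 by omega),
    br_eq_succ q (show k - 2 = k - 3 + 1 by omega),
    br_eq_succ q (show s + 4 - k = s + 3 - k + 1 by omega),
    br_eq_of_add q (show k - 3 + (s + 3 - k) = s by omega)]
  ring

theorem XX_hi_pos (hq0 : q ≠ 0) (hq : ∀ m, br q (m + 1) ≠ 0) (s a b k : ℕ) (h3 : 3 ≤ a)
    (hak : a < k) (hk : k ≤ s + 3) (hbk : k ≤ b) (h2 : b ≤ s + 4) : XX q x (s + 5) a b k =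
      br q (s + 5) * br q (a - 1) * br q (b - 2) * fct q (s + 1) * br q (s + 4 - k) *
        es x (s + 5) +
      fct q s * (br q (s + 4) * br q (a - 1) * br q (b - 3) * (q ^ (s + 4 - k) * br q (k - 2)) +
        br q (s + 4 - k) * br q (b - 3) * br q (s + 2) * (q ^ (a - 1) * br q (s + 5 - a)) +
        br q (s + 4 - k) * br q (s + 3) * br q (a - 1) * (q ^ (b - 2) * br q (s + 4 - b))) *
        (es x (s + 4) * es x 1) +
      br q 2 * br q (s + 1) * fct q (s - 1) *
        ((q ^ (b - k) * br q (s + 4 - b)) *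
          (q * ((q ^ (a - 2) * br q (s + 3 - a)) * (q ^ (k - 3) * br q (s + 3 - k)) +
            q ^ (s + 1) * br q s + q ^ s * br q (k - 3) +
            q ^ (s + 1) * br q 2 * br q (a - 2) * br q (k - 3))) +
          q ^ (s + 2) * br q (b - k) * br q s * br q (a - 1)) * (es x (s + 3) * es x 2) +
      fct q s * br q (s + 2) * (q * q ^ (s + 4 - k) * (q ^ (a - 2) * br q (k - a)) *
        br q (b - 3)) * (es x (s + 3) * es x 1 ^ 2) +
      br q 3 * fct q (s - 1) * q ^ s *
        (q ^ (a - 1) * br q (s + 2 - a) * (q ^ (b - k) * br q (s + 4 - b)) * br q (k - 2) +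
          q ^ (b - 2) * br q (s + 4 - b) * br q (s + 4 - k) * br q (a - 2)) *
        (es x (s + 2) * es x 3) +
      fct q s * q ^ (s + 2) * (q ^ (b - k) * br q (s + 4 - b)) * (q ^ (a - 2) * br q (k - a)) *
        (es x (s + 2) * (es x 2 * es x 1)) := by
  have hg : fct q s = br q s * fct q (s - 1) := by
    rw [← Nat.sub_add_cancel (show 1 ≤ s by omega), fct_succ, Nat.add_sub_cancel]
  refine mul_left_cancel₀ hq0 ?_
  rw [XX_hi x hq0 hq s _ hg a b k (by omega) (by omega) (by omega) hbk (by omega),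
    pow_mul_br q (show s + 4 - k + (k - 2) = s + 2 by omega),
    pow_mul_br q (show a - 1 + (s + 5 - a) = s + 4 by omega),
    pow_mul_br q (show b - 2 + (s + 4 - b) = s + 2 by omega),
    pow_mul_br q (show b - k + (s + 4 - b) = s + 4 - k by omega),
    pow_mul_br q (show a - 2 + (s + 3 - a) = s + 1 by omega),
    pow_mul_br q (show k - 3 + (s + 3 - k) = s by omega),
    pow_mul_br q (show a - 2 + (k - a) = k - 2 by omega),
    pow_mul_br q (show a - 1 + (s + 2 - a) = s + 1 by omega),
    pow_eq_br q (s + 4 - k), pow_eq_br q (s + 1), pow_eq_br q (s + 2), pow_eq_br q s]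
  simp only [PP2, Phi2, Phi3, br_succ, br_zero, fct_succ, hg,
    br_eq_succ q (show b - 2 = b - 3 + 1 by omega),
    br_eq_succ q (show a - 1 = a - 2 + 1 by omega),
    br_eq_succ q (show k - 2 = k - 3 + 1 by omega),
    br_eq_succ q (show s + 4 - k = s + 3 - k + 1 by omega),
    br_eq_of_add q (show k - 3 + (b - k) = b - 3 by omega),
    br_eq_of_add q (show k - 3 + (s + 3 - k) = s by omega)]
  ring

end PositiveForms

section EPositivity

open Polynomial

/-- The ring of polynomials in `x₁, …, x_N` over `ℤ[q]`. -/
abbrev QPoly (N : ℕ) := MvPolynomial (Fin N) ℤ[X]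

/-- The variable `q`. -/
noncomputable abbrev qv (N : ℕ) : QPoly N := MvPolynomial.C X

/-- The coefficient homomorphism from `ℕ[q]`. -/
noncomputable def coeffHom (N : ℕ) : ℕ[X] →+* QPoly N :=
  MvPolynomial.C.comp (mapRingHom (Nat.castRingHom ℤ))

theorem coeffHom_X (N : ℕ) : coeffHom N X = qv N := by simp [coeffHom]

/-- A family of scalars which is the image of one polynomial with natural coefficients. -/
def NatCoeff (r : ∀ N, QPoly N) : Prop := ∃ p, ∀ N, r N = coeffHom N p

theorem NatCoeff.q_pow (n : ℕ) : NatCoeff fun N => qv N ^ n :=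
  ⟨X ^ n, fun N => by rw [map_pow, coeffHom_X]⟩

theorem NatCoeff.q : NatCoeff qv := ⟨X, fun N => (coeffHom_X N).symm⟩

theorem NatCoeff.br (n : ℕ) : NatCoeff fun N => br (qv N) n :=
  ⟨UnitInterval.br X n, fun N => by rw [map_br, coeffHom_X]⟩

theorem NatCoeff.fct (n : ℕ) : NatCoeff fun N => fct (qv N) n :=
  ⟨UnitInterval.fct X n, fun N => by rw [map_fct, coeffHom_X]⟩

theorem NatCoeff.add {r r' : ∀ N, QPoly N} (h : NatCoeff r) (h' : NatCoeff r') :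
    NatCoeff fun N => r N + r' N := by
  obtain ⟨p, hp⟩ := h
  obtain ⟨p', hp'⟩ := h'
  exact ⟨p + p', fun N => by simp only [map_add, hp, hp']⟩

theorem NatCoeff.mul {r r' : ∀ N, QPoly N} (h : NatCoeff r) (h' : NatCoeff r') :
    NatCoeff fun N => r N * r' N := by
  obtain ⟨p, hp⟩ := h
  obtain ⟨p', hp'⟩ := h'
  exact ⟨p * p', fun N => by simp only [map_mul, hp, hp']⟩

/-- The product of the elementary symmetric polynomials indexed by a multiset. -/
noncomputable def esProd (N : ℕ) (s : Multiset ℕ) : QPoly N :=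
  (s.map fun r => es (MvPolynomial.X : Fin N → QPoly N) r).prod

/-- `e`-positivity of a family of symmetric polynomials of degree `n`. -/
def EPos (n : ℕ) (F : ∀ N, QPoly N) : Prop :=
  ∃ c : n.Partition → ℕ[X], ∀ N, F N = ∑ P, coeffHom N (c P) * esProd N P.parts

theorem EPos.congr {n : ℕ} {F G : ∀ N, QPoly N} (h : ∀ N, F N = G N) (hG : EPos n G) :
    EPos n F := by
  rwa [funext h]

theorem EPos.es {n : ℕ} (hn : n ≠ 0) : EPos n fun _ => es MvPolynomial.X n := by
  refine ⟨Pi.single (Nat.Partition.indiscrete n) 1, fun N => ?_⟩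
  rw [sum_eq_single (Nat.Partition.indiscrete n)]
  · simp [esProd, Nat.Partition.indiscrete_parts hn]
  · intro P _ hP
    rw [Pi.single_eq_of_ne hP, map_zero, zero_mul]
  · simp

theorem EPos.add {n : ℕ} {F G : ∀ N, QPoly N} (hF : EPos n F) (hG : EPos n G) :
    EPos n fun N => F N + G N := by
  obtain ⟨c, hc⟩ := hF
  obtain ⟨c', hc'⟩ := hG
  refine ⟨fun P => c P + c' P, fun N => ?_⟩
  simp only [hc, hc', map_add, add_mul, sum_add_distrib]

theorem EPos.smul {n : ℕ} {r F : ∀ N, QPoly N} (hr : NatCoeff r) (hF : EPos n F) :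
    EPos n fun N => r N * F N := by
  obtain ⟨p, hp⟩ := hr
  obtain ⟨c, hc⟩ := hF
  refine ⟨fun P => p * c P, fun N => ?_⟩
  simp only [hc, hp, map_mul, mul_assoc, mul_sum]

theorem EPos.mul {m n l : ℕ} {F G : ∀ N, QPoly N} (hF : EPos m F) (hG : EPos n G)
    (h : m + n = l) : EPos l fun N => F N * G N := by
  subst h
  obtain ⟨c, hc⟩ := hF
  obtain ⟨c', hc'⟩ := hG
  let u : m.Partition × n.Partition → (m + n).Partition := fun p =>
    ⟨p.1.parts + p.2.parts, fun {i} hi => (Multiset.mem_add.mp hi).elim p.1.parts_pos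
      p.2.parts_pos, by rw [Multiset.sum_add, p.1.parts_sum, p.2.parts_sum]⟩
  refine ⟨fun P => ∑ p with u p = P, c p.1 * c' p.2, fun N => ?_⟩
  beta_reduce
  rw [hc, hc', sum_mul_sum, ← sum_product', univ_product_univ, ← sum_fiberwise _ u]
  refine sum_congr rfl fun P _ => ?_
  rw [map_sum, sum_mul]
  refine sum_congr rfl fun p hp => ?_
  rw [← (mem_filter.mp hp).2, map_mul]
  simp only [u, esProd, Multiset.map_add, Multiset.prod_add]
  ring

theorem EPos.es_mul_es {m n l : ℕ} (hm : m ≠ 0) (hn : n ≠ 0) (h : m + n = l) :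
    EPos l fun _ => UnitInterval.es MvPolynomial.X m * UnitInterval.es MvPolynomial.X n :=
  (EPos.es hm).mul (EPos.es hn) h

theorem EPos.es_mul_es_mul_es {i j k l : ℕ} (hi : i ≠ 0) (hj : j ≠ 0) (hk : k ≠ 0)
    (h : i + (j + k) = l) : EPos l fun _ => UnitInterval.es MvPolynomial.X i *
      (UnitInterval.es MvPolynomial.X j * UnitInterval.es MvPolynomial.X k) :=
  (EPos.es hi).mul (.es_mul_es hj hk rfl) h

theorem qv_ne_zero (N : ℕ) : qv N ≠ 0 := by simp [qv]

theorem br_qv_ne_zero (N m : ℕ) : br (qv N) (m + 1) ≠ 0 := by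
  intro h
  rw [qv, ← map_br, MvPolynomial.C_eq_zero] at h
  have h1 := congrArg (evalRingHom 1) h
  rw [map_br] at h1
  simp [br] at h1
  omega

theorem EPos.XX {s a b k : ℕ} (ha : 2 ≤ a) (hab : a ≤ b) (hak : a < k) (hk : k ≤ s + 3)
    (hb : b ≤ s + 4) : EPos (s + 5) fun N => XX (qv N) MvPolynomial.X (s + 5) a b k := by
  rcases le_total b k with hbk | hbk <;> rcases ha.eq_or_lt with rfl | ha'
  on_goal 1 => rcases hab.eq_or_lt with rfl | hb'
  on_goal 1 => refine .congr (fun N =>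
    XX_two_two_pos _ (qv_ne_zero N) (br_qv_ne_zero N) s k hak hk) ?_
  on_goal 2 => refine .congr (fun N =>
    XX_two_lo_pos _ (qv_ne_zero N) (br_qv_ne_zero N) s b k hb' hbk hk) ?_
  on_goal 3 => refine .congr (fun N =>
    XX_lo_pos _ (qv_ne_zero N) (br_qv_ne_zero N) s a b k ha' hab hbk hak hk) ?_
  on_goal 4 => refine .congr (fun N =>
    XX_two_hi_pos _ (qv_ne_zero N) (br_qv_ne_zero N) s b k hak hk hbk hb) ?_
  on_goal 5 => refine .congr (fun N =>
    XX_hi_pos _ (qv_ne_zero N) (br_qv_ne_zero N) s a b k ha' hak hk hbk hb) ?_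
  all_goals
    try simp only [sq (UnitInterval.es _ _)]
    with_reducible repeat' first
      | exact .q | exact .q_pow _ | exact .br _ | exact .fct _ | apply NatCoeff.mul
      | apply NatCoeff.add | exact .es (by omega)
      | exact .es_mul_es (by omega) (by omega) (by omega)
      | exact .es_mul_es_mul_es (by omega) (by omega) (by omega) (by omega)
      | apply EPos.add | apply EPos.smul

theorem EPos.JJ {n a b : ℕ} (ha : 2 ≤ a) (hab : a ≤ b) (han : a < n) (hb : b ≤ n) :
    EPos n fun N => JJ (qv N) MvPolynomial.X n a b := by
  obtain ⟨m, rfl⟩ := Nat.exists_eq_add_of_le' (show 3 ≤ n by omega)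
  rcases ha.eq_or_lt with rfl | ha
  · refine .congr (fun N => JJ_two_pos _ (br_qv_ne_zero N) m b hab hb) ?_
    with_reducible repeat' first
      | exact .q | exact .q_pow _ | exact .br _ | exact .fct _ | apply NatCoeff.mul
      | apply NatCoeff.add | exact .es (by omega)
      | exact .es_mul_es (by omega) (by omega) (by omega)
      | apply EPos.add | apply EPos.smul
  · obtain ⟨m, rfl⟩ := Nat.exists_eq_add_of_le' (show 1 ≤ m by omega)
    refine .congr (fun N =>
      JJ_pos _ (br_qv_ne_zero N) m a b (by omega) hab (by omega) (by omega)) ?_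
    with_reducible repeat' first
      | exact .q | exact .q_pow _ | exact .br _ | exact .fct _ | apply NatCoeff.mul
      | apply NatCoeff.add | exact .es (by omega)
      | exact .es_mul_es (by omega) (by omega) (by omega)
      | apply EPos.add | apply EPos.smul

theorem EPos.JJ_top {n a : ℕ} (hn : 2 ≤ n) (ha : 1 ≤ a) (han : a ≤ n) :
    EPos n fun N => UnitInterval.JJ (qv N) MvPolynomial.X n a n := by
  obtain ⟨m, rfl⟩ := Nat.exists_eq_add_of_le' hn
  refine .congr (fun N => JJ_top_pos _ (br_qv_ne_zero N) m a ha han) ?_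
  with_reducible repeat' first
    | exact .q | exact .q_pow _ | exact .br _ | exact .fct _ | apply NatCoeff.mul
    | apply NatCoeff.add | exact .es (by omega)
    | exact .es_mul_es (by omega) (by omega) (by omega)
    | apply EPos.add | apply EPos.smul

theorem EPos.FF {n a k : ℕ} (hk : 1 ≤ k) (hka : k ≤ a) (ha : a < n) :
    EPos n fun N => FF (qv N) MvPolynomial.X n a k := by
  rcases hk.eq_or_lt with rfl | hk
  · simp only [FF_one]
    exact .JJ_top (by omega) hka ha.le
  rcases (show 2 ≤ k from hk).eq_or_lt with rfl | hk
  · simp only [FF_two]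
    exact .JJ hka (by omega) ha (by omega)
  obtain ⟨m, rfl⟩ := Nat.exists_eq_add_of_le' (show 4 ≤ n by omega)
  refine .congr (fun N => FF_pos _ (qv_ne_zero N) (br_qv_ne_zero N) m a k (by omega) hka
    (by omega) (by omega)) ?_
  with_reducible repeat' first
    | exact .q | exact .q_pow _ | exact .br _ | exact .fct _ | apply NatCoeff.mul
    | apply NatCoeff.add | exact .es (by omega)
    | exact .es_mul_es (by omega) (by omega) (by omega)
    | apply EPos.add | apply EPos.smul

end EPositivity

section Bridge

theorem esymm_eq_es (N r : ℕ) :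
    MvPolynomial.esymm (Fin N) (Polynomial ℤ) r = es (MvPolynomial.X : Fin N → QPoly N) r := by
  rw [MvPolynomial.esymm, es]

variable {n : ℕ} (D : DyckPath n)

theorem incomp_iff {u v : ℕ} (huv : u < v) (hv : v < n) :
    D.Incomp (u + 1) (v + 1) ↔ v < D.d (u + 1) := by
  have := D.ge_self (v + 1) (by omega) hv
  simp only [DyckPath.Incomp, DyckPath.prec]
  omega

theorem incomp_comm {x y : ℕ} : D.Incomp x y ↔ D.Incomp y x := and_comm

theorem isProperColoring_iff {N : ℕ} (κ : Fin n → Fin N) :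
    D.IsProperColoring κ ↔ ∀ p ∈ edges n fun i => D.d (i + 1), κ p.1 ≠ κ p.2 := by
  simp only [DyckPath.IsProperColoring, edges, mem_filter, mem_univ, true_and, Prod.forall]
  refine ⟨fun h u v huv => h u v ((incomp_iff D huv.1 v.2).mpr huv.2) huv.1.ne, fun h u v hi hne => ?_⟩
  rcases lt_or_gt_of_ne hne with huv | huv
  · exact h u v ⟨huv, (incomp_iff D huv v.2).mp hi⟩
  · exact (h v u ⟨huv, (incomp_iff D huv u.2).mp ((incomp_comm D).mp hi)⟩).symm

theorem prod_wt_eq {N : ℕ} (κ : Fin n → Fin N) :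
    ∏ p ∈ edges n fun i => D.d (i + 1), wt (qv N) (κ p.1) (κ p.2) =
      if D.IsProperColoring κ then qv N ^ D.ascNum κ else 0 := by
  split_ifs with h
  · rw [isProperColoring_iff] at h
    have hw : ∀ p ∈ edges n fun i => D.d (i + 1), wt (qv N) (κ p.1) (κ p.2) =
        if κ p.1 < κ p.2 then qv N else 1 := by
      intro p hp
      rcases lt_or_gt_of_ne (h p hp) with hlt | hlt <;> simp [wt, hlt, hlt.not_gt]
    rw [prod_congr rfl hw, prod_ite, prod_const, prod_const_one, mul_one, DyckPath.ascNum]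
    congr 2
    ext p
    simp only [edges, mem_filter, mem_univ, true_and, and_assoc]
    exact and_congr_right fun hp => and_congr_left fun _ => (incomp_iff D hp p.2.2).symm
  · rw [isProperColoring_iff] at h
    push Not at h
    obtain ⟨p, hp, he⟩ := h
    exact prod_eq_zero hp (by simp [wt, he])

theorem Xq_eq_chie (N : ℕ) :
    D.Xq N = chie (qv N) MvPolynomial.X n fun i => D.d (i + 1) := by
  simp only [DyckPath.Xq, chie, chi, prod_wt_eq, sum_filter, ite_mul, zero_mul, map_pow]

theorem ePos_Xq (hform : ∀ i : ℕ, 3 ≤ i → i < n → D.d i = n - 1 ∨ D.d i = n)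
    (h3 : D.BounceThree) : EPos n D.Xq := by
  obtain ⟨h0, h1, h2⟩ := h3
  simp only [DyckPath.m0, DyckPath.m1, DyckPath.bounce] at h0 h1 h2
  have hd1 := D.ge_self 1 le_rfl (by omega)
  have hd2 := D.ge_self (D.d 1 + 1) (by omega) (by omega)
  have h12 := D.mono 1 2 le_rfl (by omega) (by omega)
  have hb : D.d 2 < n := (D.mono 2 (D.d 1 + 1) (by omega) (by omega) (by omega)).trans_lt h1
  have hd22 := D.ge_self 2 (by omega) (by omega)
  -- `k` is the last index from `2` on whose row stops before `n`
  obtain ⟨k, hk2, hkn, hk⟩ : ∃ k, 2 ≤ k ∧ k < n ∧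
      ∀ i, 3 ≤ i → i ≤ n → (D.d i = if i ≤ k then n - 1 else n) := by
    refine ⟨Nat.findGreatest (fun i => D.d i < n) n, Nat.le_findGreatest (by omega) hb, ?_, ?_⟩
    · refine lt_of_le_of_ne (Nat.findGreatest_le n) fun h => ?_
      have := Nat.findGreatest_spec (P := fun i => D.d i < n) (by omega : 2 ≤ n) hb
      rw [h, D.top] at this
      exact lt_irrefl _ this
    · intro i hi hin
      have hg := Nat.findGreatest_spec (P := fun i => D.d i < n) (by omega : 2 ≤ n) hb
      have hle := D.le_n i (by omega) hin
      split_ifs with hik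
      · have := D.mono i _ (by omega) hik (Nat.findGreatest_le n)
        have hne : i ≠ n := by
          rintro rfl
          rw [D.top] at this
          omega
        have := hform i hi (by omega)
        omega
      · have := Nat.findGreatest_is_greatest (P := fun i => D.d i < n) (not_le.mp hik) hin
        omega
  rcases hd1.eq_or_lt with ha | ha
  · -- the vertex `1` is isolated
    obtain ⟨m, rfl⟩ := Nat.exists_eq_add_of_le (show 1 ≤ n by omega)
    rw [← ha] at h1 h2
    simp only [Nat.reduceAdd] at h1 h2
    have hkb : k ≤ D.d 2 := by
      by_contra hlt
      have := hk (D.d 2 + 1) (by omega) (by omega)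
      rw [h2, if_pos (by omega)] at this
      omega
    refine .congr (fun N => ?_) (.mul (.es one_ne_zero)
      (.FF (n := m) (a := D.d 2 - 1) (k := k - 1) (by omega) (by omega) (by omega)) rfl)
    rw [Xq_eq_chie, chie_mul _ _ 1 m _ (fun i hi => by rw [Nat.lt_one_iff.mp hi]; exact ha.ge),
      chie_one, UnitInterval.FF]
    congr 1
    refine chie_congr _ _ fun i j hij hj => ?_
    rcases Nat.eq_zero_or_pos i with rfl | hi
    · simp
    · rw [hk (i + 1 + 1) (by omega) (by omega)]
      split_ifs <;> omega
  · have hak : D.d 1 < k := by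
      by_contra hlt
      have := hk (D.d 1 + 1) (by omega) (by omega)
      rw [if_neg (by omega)] at this
      omega
    have hXX : ∀ N, D.Xq N = XX (qv N) MvPolynomial.X n (D.d 1) (D.d 2) k := by
      intro N
      rw [Xq_eq_chie, XX]
      refine chie_congr _ _ fun i j hij hj => ?_
      rcases i with _ | _ | i
      · simp
      · simp
      · rw [hk (i + 1 + 1 + 1) (by omega) (by omega)]
        simp only [Nat.add_eq_zero_iff, one_ne_zero, and_false, if_false]
        split_ifs <;> omega
    rcases (show k ≤ n - 1 by omega).eq_or_lt with rfl | hk'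
    · obtain ⟨m, rfl⟩ := Nat.exists_eq_add_of_le' (show 1 ≤ n by omega)
      refine .congr (fun N => (hXX N).trans (XX_last _ _ m _ _ (by omega) (by omega)))
        (.mul (.es one_ne_zero) (.JJ ha h12 (by omega) (by omega)) (Nat.add_comm 1 m))
    · obtain ⟨s, rfl⟩ := Nat.exists_eq_add_of_le' (show 5 ≤ n by omega)
      exact .congr hXX (.XX ha h12 hak (by omega) (by omega))

end Bridge

end UnitInterval

/-- **Theorem `epos1`.** For a Dyck path `d = (d₁, d₂, n-1, …, n-1, n, …, n)`
of bounce number three, `X_{inc(P(d))}(x, q)` is `e`-positive: there are polynomials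
`c_λ(q) ∈ ℕ[q]` indexed by partitions `λ ⊢ n` such that for every `N ≥ n`,
`X_G(x₁,…,x_N; q) = Σ_{λ ⊢ n} c_λ(q) · e_{λ₁} ⋯ e_{λ_ℓ}`. -/
theorem Xq_e_positive
    (n : ℕ) (D : DyckPath n)
    (hform : ∀ i : ℕ, 3 ≤ i → i < n → D.d i = n - 1 ∨ D.d i = n)
    (h3 : D.BounceThree) :
    ∃ c : Nat.Partition n → Polynomial ℕ,
      ∀ N : ℕ, n ≤ N →
        D.Xq N = ∑ P : Nat.Partition n,
          MvPolynomial.C ((c P).map (Nat.castRingHom ℤ)) *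
            (P.parts.map fun r => MvPolynomial.esymm (Fin N) (Polynomial ℤ) r).prod := by
  obtain ⟨c, hc⟩ := UnitInterval.ePos_Xq D hform h3
  refine ⟨c, fun N _ => ?_⟩
  simp only [hc N, UnitInterval.esProd, ← UnitInterval.esymm_eq_es]
  rfl
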